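/- Let u ∈ P_∞⁺(0,M) satisfy u ≥ 0 in ℝ₊ⁿ, and suppose u is differentiable at every point of Π with ∇u = 0 on Π. Then u is convex on the half-space, i.e. for all x, y in the closed half-space {x₁ ≥ 0} and all t ∈ [0,1], u(tx + (1−t)y) ≤ t·u(x) + (1−t)·u(y). (Intermediate step in the proof of Theorem B.) -/

import Mathlib

open Metric Set MeasureTheory Filter

noncomputable section

attribute [local instance] Matrix.normedAddCommGroup Matrix.normedSpace

/-- Euclidean space ℝⁿ. -/
abbrev En (n : ℕ) := EuclideanSpace ℝ (Fin n)

/-- The open half-space `{x : x₁ > 0}`. -/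
def HplusSet (n : ℕ) [NeZero n] : Set (En n) := {x | 0 < x 0}

/-- The closed half-space `{x : x₁ ≥ 0}`. -/
def HcloSet (n : ℕ) [NeZero n] : Set (En n) := {x | 0 ≤ x 0}

/-- The hyperplane `Π = {x : x₁ = 0}`. -/
def PiSet (n : ℕ) [NeZero n] : Set (En n) := {x | x 0 = 0}

/-- The half-ball `B⁺(z,r)`. -/
def Bplus (n : ℕ) [NeZero n] (z : En n) (r : ℝ) : Set (En n) := HplusSet n ∩ ball z r

/-- Operator norm of a matrix acting on Euclidean space. -/
def matOpNorm {n : ℕ} (N : Matrix (Fin n) (Fin n) ℝ) : ℝ :=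
  ‖(Matrix.toEuclideanCLM (𝕜 := ℝ) N : EuclideanSpace ℝ (Fin n) →L[ℝ] EuclideanSpace ℝ (Fin n))‖

/-- The structural assumptions on the fully nonlinear operator `F`:
uniform ellipticity with constants `0 < lam ≤ Lam`, positive one-homogeneity,
convexity (on symmetric matrices) and `C¹` smoothness. -/
structure EllipticF (n : ℕ) (lam Lam : ℝ) (F : Matrix (Fin n) (Fin n) ℝ → ℝ) : Prop where
  lam_pos : 0 < lam
  lam_le_Lam : lam ≤ Lam
  elliptic_lower : ∀ A N : Matrix (Fin n) (Fin n) ℝ, A.IsSymm → N.PosSemidef →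
    lam * matOpNorm N ≤ F (A + N) - F A
  elliptic_upper : ∀ A N : Matrix (Fin n) (Fin n) ℝ, A.IsSymm → N.PosSemidef →
    F (A + N) - F A ≤ Lam * matOpNorm N
  homogeneous : ∀ (t : ℝ) (A : Matrix (Fin n) (Fin n) ℝ), F (t • A) = t * F A
  convexF : ConvexOn ℝ {A : Matrix (Fin n) (Fin n) ℝ | A.IsSymm} F
  smoothF : ContDiff ℝ 1 F

/-- The quadratic polynomial `x ↦ c + b·x + ½ xᵀAx`. -/
def quadPoly {n : ℕ} (c : ℝ) (b : En n) (A : Matrix (Fin n) (Fin n) ℝ) (x : En n) : ℝ :=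
  c + ∑ i, b i * x i + (1 / 2) * ∑ i, ∑ j, A i j * x i * x j

/-- `u` is a viscosity solution of `F(D²u) = g` in the open set `D`. -/
def ViscositySol {n : ℕ} (F : Matrix (Fin n) (Fin n) ℝ → ℝ) (g : En n → ℝ) (D : Set (En n))
    (u : En n → ℝ) : Prop :=
  ∀ x₀ ∈ D,
    (∀ (c : ℝ) (b : En n) (A : Matrix (Fin n) (Fin n) ℝ), A.IsSymm →
      IsLocalMaxOn (fun x => u x - quadPoly c b A x) D x₀ → g x₀ ≤ F A) ∧
    (∀ (c : ℝ) (b : En n) (A : Matrix (Fin n) (Fin n) ℝ), A.IsSymm →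
      IsLocalMinOn (fun x => u x - quadPoly c b A x) D x₀ → F A ≤ g x₀)

/-- Membership in the class `P_r⁺(z,M)` of local solutions, with associated open set `Ω`. -/
structure MemPplus {n : ℕ} [NeZero n] (F : Matrix (Fin n) (Fin n) ℝ → ℝ) (z : En n) (r M : ℝ)
    (u : En n → ℝ) (Ω : Set (En n)) : Prop where
  cont : ContinuousOn u (closure (Bplus n z r))
  Ω_open : IsOpen Ω
  Ω_sub : Ω ⊆ HplusSet n
  sol : ViscositySol F (Ω.indicator fun _ => (1 : ℝ)) (Bplus n z r) u
  vanish : ∀ x ∈ Bplus n z r \ Ω, u x = 0 ∧ HasGradientAt u 0 x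
  bdd : ∀ x ∈ Bplus n z r, |u x| ≤ M
  bdry_zero : ∀ x ∈ PiSet n ∩ ball (0 : En n) 1, u x = 0
  z_bdry : z ∈ frontier Ω

/-- Membership in the class `P_∞⁺(0,M)` of global solutions, with associated open set `Ω`. -/
structure MemPinf {n : ℕ} [NeZero n] (F : Matrix (Fin n) (Fin n) ℝ → ℝ) (M : ℝ)
    (u : En n → ℝ) (Ω : Set (En n)) : Prop where
  cont : ContinuousOn u (HcloSet n)
  Ω_open : IsOpen Ω
  Ω_sub : Ω ⊆ HplusSet n
  sol : ViscositySol F (Ω.indicator fun _ => (1 : ℝ)) (HplusSet n) u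
  vanish : ∀ x ∈ HplusSet n \ Ω, u x = 0 ∧ HasGradientAt u 0 x
  growth : ∀ x, |u x| ≤ M * (‖x‖ ^ 2 + 1)
  bdry_zero : ∀ x ∈ PiSet n, u x = 0
  zero_bdry : (0 : En n) ∈ frontier Ω

/-- The density `V_r(z,u) = vol(Ω⁻(u) ∩ B⁺(z,r)) / rⁿ`. -/
def Vr {n : ℕ} [NeZero n] (u : En n → ℝ) (Ω : Set (En n)) (z : En n) (r : ℝ) : ℝ :=
  (volume ({x ∈ Ω | u x < 0} ∩ Bplus n z r)).toReal / r ^ n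

/-- A modulus of continuity: nonnegative, nondecreasing on `(0,∞)` and tending to `0` at `0⁺`. -/
def IsModulus (σ : ℝ → ℝ) : Prop :=
  (∀ r : ℝ, 0 < r → 0 ≤ σ r) ∧ (∀ ⦃r s : ℝ⦄, 0 < r → r ≤ s → σ r ≤ σ s) ∧
    Tendsto σ (nhdsWithin 0 (Ioi 0)) (nhds 0)


abbrev Pol (n : ℕ) := MvPolynomial (Fin n) ℝ

def ev {n : ℕ} (x : En n) : Pol n →+* ℝ := MvPolynomial.eval (fun i => x i)

def QF {n : ℕ} (A : Matrix (Fin n) (Fin n) ℝ) (y : En n) : ℝ := ∑ i, ∑ j, A i j * y i * y j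

def LA {n : ℕ} (a A : Matrix (Fin n) (Fin n) ℝ) : ℝ := ∑ i, ∑ j, a i j * A i j

def Lop {n : ℕ} (a : Matrix (Fin n) (Fin n) ℝ) (q : Pol n) : Pol n :=
  ∑ i, ∑ j, MvPolynomial.C (a i j) * MvPolynomial.pderiv i (MvPolynomial.pderiv j q)

def Hes {n : ℕ} (q : Pol n) (x : En n) : Matrix (Fin n) (Fin n) ℝ :=
  Matrix.of fun i j => ev x (MvPolynomial.pderiv i (MvPolynomial.pderiv j q))

def ViSub {n : ℕ} (a : Matrix (Fin n) (Fin n) ℝ) (U : En n → ℝ) (c : ℝ) (x : En n) : Prop :=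
  ∀ (c0 : ℝ) (b : En n) (A : Matrix (Fin n) (Fin n) ℝ), A.IsSymm →
    IsLocalMax (fun y => U y - quadPoly c0 b A y) x → c ≤ LA a A

def ViSup {n : ℕ} (a : Matrix (Fin n) (Fin n) ℝ) (U : En n → ℝ) (c : ℝ) (x : En n) : Prop :=
  ∀ (c0 : ℝ) (b : En n) (A : Matrix (Fin n) (Fin n) ℝ), A.IsSymm →
    IsLocalMin (fun y => U y - quadPoly c0 b A y) x → LA a A ≤ c

/-- Structural facts on the coefficient matrix. -/
structure Coef {n : ℕ} (a : Matrix (Fin n) (Fin n) ℝ) (lam : ℝ) : Prop where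
  symm : ∀ i j, a i j = a j i
  lam_pos : 0 < lam
  low : ∀ y : Fin n → ℝ, lam * ∑ i, y i ^ 2 ≤ ∑ i, ∑ j, a i j * y i * y j
  pos : ∀ A : Matrix (Fin n) (Fin n) ℝ, A.PosSemidef → 0 ≤ LA a A

lemma QF_add {n : ℕ} (A : Matrix (Fin n) (Fin n) ℝ) (hA : A.IsSymm) (x y : En n) :
    QF A (x + y) = QF A x + 2 * ∑ i, (∑ j, A i j * x j) * y i + QF A y := by
  have h1 : ∑ i, ∑ j, A i j * x i * y j = ∑ i, (∑ j, A i j * x j) * y i := by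
    rw [Finset.sum_comm]
    refine Finset.sum_congr rfl fun i _ => ?_
    rw [Finset.sum_mul]
    refine Finset.sum_congr rfl fun j _ => ?_
    rw [hA.apply i j]
  have h2 : ∑ i, ∑ j, A i j * y i * x j = ∑ i, (∑ j, A i j * x j) * y i := by
    refine Finset.sum_congr rfl fun i _ => ?_
    rw [Finset.sum_mul]
    refine Finset.sum_congr rfl fun j _ => ?_
    ring
  have : QF A (x + y) = QF A x + ∑ i, ∑ j, A i j * x i * y j + ∑ i, ∑ j, A i j * y i * x j
      + QF A y := by
    simp only [QF, ← Finset.sum_add_distrib]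
    refine Finset.sum_congr rfl fun i _ => Finset.sum_congr rfl fun j _ => ?_
    simp only [PiLp.add_apply]; ring
  rw [this, h1, h2]; ring

lemma quad_shift {n : ℕ} (c : ℝ) (b : En n) (A : Matrix (Fin n) (Fin n) ℝ) (hA : A.IsSymm)
    (x y : En n) : quadPoly c b A (x + y) = quadPoly c b A x +
      ∑ i, (b i + ∑ j, A i j * x j) * y i + (1 / 2) * QF A y := by
  have := QF_add A hA x y
  simp only [QF] at this
  simp only [quadPoly, this, QF]
  simp only [PiLp.add_apply, mul_add, add_mul, Finset.sum_add_distrib]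
  ring

lemma quad_exists {n : ℕ} (g : Fin n → ℝ) (A : Matrix (Fin n) (Fin n) ℝ) (hA : A.IsSymm)
    (x : En n) : ∃ c b, ∀ y, quadPoly c b A (x + y) = ∑ i, g i * y i + (1 / 2) * QF A y := by
  set b : En n := WithLp.toLp 2 (fun i => g i - ∑ j, A i j * x j) with hb
  refine ⟨- quadPoly 0 b A x, b, fun y => ?_⟩
  rw [quad_shift _ _ _ hA]
  have : quadPoly (- quadPoly 0 b A x) b A x = 0 := by simp only [quadPoly]; ring
  rw [this]
  simp [hb]

lemma abs_coord_le {n : ℕ} (y : En n) (i : Fin n) : |y i| ≤ ‖y‖ := by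
  simpa using PiLp.norm_apply_le y i

lemma QF_abs_le {n : ℕ} (A : Matrix (Fin n) (Fin n) ℝ) (y : En n) :
    |QF A y| ≤ (∑ i, ∑ j, |A i j|) * ‖y‖ ^ 2 := by
  rw [QF, Finset.sum_mul]
  refine (Finset.abs_sum_le_sum_abs _ _).trans (Finset.sum_le_sum fun i _ => ?_)
  rw [Finset.sum_mul]
  refine (Finset.abs_sum_le_sum_abs _ _).trans (Finset.sum_le_sum fun j _ => ?_)
  rw [abs_mul, abs_mul, mul_assoc, pow_two]
  have := abs_coord_le y i
  have := abs_coord_le y j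
  gcongr

lemma ev_X {n : ℕ} (x : En n) (i : Fin n) : ev x (MvPolynomial.X i) = x i := by simp [ev]
lemma ev_C {n : ℕ} (x : En n) (c : ℝ) : ev x (MvPolynomial.C c) = c := by simp [ev]

lemma ev_continuous {n : ℕ} (q : Pol n) : Continuous fun x : En n => ev x q := by
  have := MvPolynomial.continuous_eval q
  exact this.comp (by fun_prop)

lemma taylor {n : ℕ} (q : Pol n) (x : En n) : ∃ K : ℝ, 0 ≤ K ∧ ∀ y : En n, ‖y‖ ≤ 1 →
    |ev (x + y) q - ev x q - ∑ i, ev x (MvPolynomial.pderiv i q) * y i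
      - (1 / 2) * QF (Hes q x) y| ≤ K * ‖y‖ ^ 3 := by
  induction q using MvPolynomial.induction_on with
  | C c => exact ⟨0, le_rfl, fun y _ => by simp [ev_C, QF, Hes]⟩
  | add p q hp hq =>
    obtain ⟨K1, h1, H1⟩ := hp
    obtain ⟨K2, h2, H2⟩ := hq
    refine ⟨K1 + K2, by positivity, fun y hy => ?_⟩
    have e : QF (Hes (p + q) x) y = QF (Hes p x) y + QF (Hes q x) y := by
      simp only [QF, Hes, map_add, Matrix.of_apply, ← Finset.sum_add_distrib]
      refine Finset.sum_congr rfl fun i _ => Finset.sum_congr rfl fun j _ => ?_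
      ring
    have := H1 y hy
    have := H2 y hy
    rw [e]
    simp only [map_add, add_mul, Finset.sum_add_distrib]
    rw [abs_le] at *
    constructor <;> linarith
  | mul_X p k hp =>
    obtain ⟨K, h1, H⟩ := hp
    refine ⟨|x k| * K + K + ∑ i, ∑ j, |Hes p x i j|, by positivity, fun y hy => ?_⟩
    have e1 : ∑ i, ev x (MvPolynomial.pderiv i (p * MvPolynomial.X k)) * y i =
        x k * ∑ i, ev x (MvPolynomial.pderiv i p) * y i + ev x p * y k := by
      have : ∀ i, ev x (MvPolynomial.pderiv i (p * MvPolynomial.X k)) * y i =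
        x k * (ev x (MvPolynomial.pderiv i p) * y i) + if i = k then ev x p * y k else 0 := by
        intro i
        rw [MvPolynomial.pderiv_mul, map_add, map_mul, map_mul, ev_X]
        split_ifs with h
        · subst h; simp; ring
        · rw [MvPolynomial.pderiv_X_of_ne (Ne.symm h)]; simp; ring
      simp only [this, Finset.sum_add_distrib, Finset.mul_sum]
      simp
    have e2 : QF (Hes (p * MvPolynomial.X k) x) y = x k * QF (Hes p x) y +
        2 * y k * ∑ i, ev x (MvPolynomial.pderiv i p) * y i := by
      have : ∀ i j, Hes (p * MvPolynomial.X k) x i j * y i * y j =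
          x k * (Hes p x i j * y i * y j)
          + (if i = k then ev x (MvPolynomial.pderiv j p) * y j * y k else 0)
          + (if j = k then ev x (MvPolynomial.pderiv i p) * y i * y k else 0) := by
        intro i j
        have hX : ∀ i : Fin n, MvPolynomial.pderiv i (MvPolynomial.X k : Pol n)
            = MvPolynomial.C (if i = k then 1 else 0) := by
          intro i
          split_ifs with h
          · subst h; simp
          · rw [MvPolynomial.pderiv_X_of_ne (Ne.symm h)]; simp
        simp only [Hes, Matrix.of_apply, MvPolynomial.pderiv_mul, map_add, map_mul, ev_X, hX,
          MvPolynomial.pderiv_C, ev_C, map_zero]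
        split_ifs with h h' h' <;> (try subst h) <;> (try subst h') <;> ring
      simp only [QF, this, Finset.sum_add_distrib, Finset.mul_sum]
      have h3 : ∑ i, ∑ j, (if i = k then ev x (MvPolynomial.pderiv j p) * y j * y k else 0)
          = ∑ j, ev x (MvPolynomial.pderiv j p) * y j * y k := by
        rw [Finset.sum_comm]; simp
      rw [h3]
      simp only [Finset.sum_ite_eq', Finset.mem_univ, if_true]
      rw [add_assoc, ← Finset.sum_add_distrib]
      congr 1
      refine Finset.sum_congr rfl fun i _ => ?_
      ring
    rw [e1, e2, map_mul, map_mul, ev_X, ev_X]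
    set D := ∑ i, ev x (MvPolynomial.pderiv i p) * y i
    set R := ev (x + y) p - ev x p - D - (1 / 2) * QF (Hes p x) y with hR
    have hR' := H y hy
    have hq := QF_abs_le (Hes p x) y
    set S := ∑ i, ∑ j, |Hes p x i j|
    have hS : 0 ≤ S := by positivity
    have hk := abs_coord_le y k
    have : ev (x + y) p * (x + y) k - ev x p * x k - (x k * D + ev x p * y k)
        - 1 / 2 * (x k * QF (Hes p x) y + 2 * y k * D)
        = x k * R + y k * R + y k * ((1 / 2) * QF (Hes p x) y) := by
      simp only [PiLp.add_apply, hR]; ring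
    rw [this]
    have hy0 := norm_nonneg y
    have a1 : |x k * R| ≤ |x k| * K * ‖y‖ ^ 3 := by
      rw [abs_mul, mul_assoc]; gcongr
    have a2 : |y k * R| ≤ K * ‖y‖ ^ 3 := by
      rw [abs_mul]
      calc |y k| * |R| ≤ 1 * (K * ‖y‖ ^ 3) := by gcongr; exact hk.trans hy
        _ = _ := one_mul _
    have a3 : |y k * ((1 / 2) * QF (Hes p x) y)| ≤ S * ‖y‖ ^ 3 := by
      rw [abs_mul, abs_mul]
      calc |y k| * (|1/2| * |QF (Hes p x) y|) ≤ ‖y‖ * (1 * (S * ‖y‖ ^ 2)) := by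
            gcongr; rw [abs_of_pos] <;> norm_num
        _ = _ := by ring
    calc _ ≤ |x k * R| + |y k * R| + |y k * ((1 / 2) * QF (Hes p x) y)| := abs_add_three _ _ _
      _ ≤ _ := by linarith

lemma pderiv_swap {n : ℕ} (i j : Fin n) (q : Pol n) :
    MvPolynomial.pderiv i (MvPolynomial.pderiv j q) =
    MvPolynomial.pderiv j (MvPolynomial.pderiv i q) := by
  induction q using MvPolynomial.induction_on with
  | C c => simp
  | add p q hp hq => simp [hp, hq]
  | mul_X p k hp =>
    have hX : ∀ i : Fin n, MvPolynomial.pderiv i (MvPolynomial.X k : Pol n)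
            = MvPolynomial.C (if i = k then 1 else 0) := by
      intro i
      split_ifs with h
      · subst h; simp
      · rw [MvPolynomial.pderiv_X_of_ne (Ne.symm h)]; simp
    simp only [MvPolynomial.pderiv_mul, map_add, hX, MvPolynomial.pderiv_C, hp]
    ring

lemma Hes_symm {n : ℕ} (q : Pol n) (x : En n) : (Hes q x).IsSymm := by
  ext i j
  simp [Hes, pderiv_swap i j]

lemma ev_Lop {n : ℕ} (a : Matrix (Fin n) (Fin n) ℝ) (q : Pol n) (x : En n) :
    ev x (Lop a q) = LA a (Hes q x) := by
  simp [Lop, LA, Hes, map_sum, ev_C]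

lemma LA_add {n : ℕ} (a A B : Matrix (Fin n) (Fin n) ℝ) : LA a (A + B) = LA a A + LA a B := by
  simp [LA, mul_add, Finset.sum_add_distrib]

lemma LA_smul {n : ℕ} (a A : Matrix (Fin n) (Fin n) ℝ) (c : ℝ) : LA a (c • A) = c * LA a A := by
  simp only [LA, Finset.mul_sum, Matrix.smul_apply, smul_eq_mul]
  refine Finset.sum_congr rfl fun i _ => Finset.sum_congr rfl fun j _ => ?_
  ring

lemma LA_one {n : ℕ} (a : Matrix (Fin n) (Fin n) ℝ) : LA a 1 = ∑ i, a i i := by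
  simp [LA, Matrix.one_apply]

lemma QF_one {n : ℕ} (y : En n) : QF 1 y = ‖y‖ ^ 2 := by
  rw [EuclideanSpace.real_norm_sq_eq]
  simp [QF, Matrix.one_apply, pow_two]

lemma QF_addm {n : ℕ} (A B : Matrix (Fin n) (Fin n) ℝ) (y : En n) :
    QF (A + B) y = QF A y + QF B y := by
  simp [QF, add_mul, Finset.sum_add_distrib]

lemma QF_smulm {n : ℕ} (A : Matrix (Fin n) (Fin n) ℝ) (c : ℝ) (y : En n) :
    QF (c • A) y = c * QF A y := by
  simp only [QF, Finset.mul_sum, Matrix.smul_apply, smul_eq_mul]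
  refine Finset.sum_congr rfl fun i _ => Finset.sum_congr rfl fun j _ => ?_
  ring

/-- a touching polynomial is an admissible test function -/
lemma touch {n : ℕ} {a : Matrix (Fin n) (Fin n) ℝ} {U : En n → ℝ} {c : ℝ} {x : En n}
    (h : ViSub a U c x) (q : Pol n) (hm : IsLocalMax (fun y => U y - ev y q) x) :
    c ≤ ev x (Lop a q) := by
  rw [ev_Lop]
  obtain ⟨K, hK, HK⟩ := taylor q x
  have key : ∀ ε : ℝ, 0 < ε → c ≤ LA a (Hes q x) + ε * (2 * LA a 1) := by
    intro ε hε
    have hs : (Hes q x + (2 * ε) • (1 : Matrix (Fin n) (Fin n) ℝ)).IsSymm := by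
      apply Matrix.IsSymm.add (Hes_symm q x)
      exact (Matrix.isSymm_one).smul _
    obtain ⟨c0, b, hq⟩ := quad_exists (fun i => ev x (MvPolynomial.pderiv i q)) _ hs x
    have := h c0 b _ hs ?_
    · rw [LA_add, LA_smul] at this; linarith
    · have hnear : ∀ᶠ z in nhds x, ‖z - x‖ < min 1 (ε / (K + 1)) := by
        have : Metric.ball x (min 1 (ε / (K + 1))) ∈ nhds x :=
          Metric.ball_mem_nhds _ (by positivity)
        filter_upwards [this] with z hz
        rwa [← dist_eq_norm]
      filter_upwards [hm, hnear] with z hz hz2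
      have e : z = x + (z - x) := by abel
      set y := z - x
      have hx0 := hq 0
      have hxy := hq y
      have ht := HK y (hz2.le.trans (min_le_left _ _))
      rw [add_zero] at hx0
      have hy0 := norm_nonneg y
      have hKy : K * ‖y‖ ^ 3 ≤ ε * ‖y‖ ^ 2 := by
        have h1 : ‖y‖ ≤ ε / (K + 1) := hz2.le.trans (min_le_right _ _)
        rw [le_div_iff₀ (by positivity)] at h1
        have : K * ‖y‖ ≤ ε := by nlinarith
        calc K * ‖y‖ ^ 3 = (K * ‖y‖) * ‖y‖ ^ 2 := by ring
          _ ≤ _ := by gcongr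
      rw [QF_addm, QF_smulm, QF_one] at hxy
      have hx0' : quadPoly c0 b (Hes q x + (2 * ε) • (1 : Matrix (Fin n) (Fin n) ℝ)) x = 0 := by
        rw [hx0]; simp [QF]
      rw [e] at hz
      rw [e, hxy, hx0']
      rw [abs_le] at ht
      linarith [ht.1, ht.2]
  by_contra hcon
  push Not at hcon
  have := key ((c - LA a (Hes q x)) / (2 * (|2 * LA a 1| + 1))) (by
    have : 0 < c - LA a (Hes q x) := by linarith
    positivity)
  have h2 : (c - LA a (Hes q x)) / (2 * (|2 * LA a 1| + 1)) * (2 * LA a 1) ≤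
    (c - LA a (Hes q x)) / (2 * (|2 * LA a 1| + 1)) * (|2 * LA a 1| + 1) := by
    have : 0 < c - LA a (Hes q x) := by linarith
    gcongr
    linarith [le_abs_self (2 * LA a 1)]
  have h3 : (c - LA a (Hes q x)) / (2 * (|2 * LA a 1| + 1)) * (|2 * LA a 1| + 1)
      = (c - LA a (Hes q x)) / 2 := by
    have : |2 * LA a 1| + 1 ≠ 0 := by positivity
    field_simp
  linarith


def sP {n : ℕ} (z : En n) (r : ℝ) : Pol n :=
  MvPolynomial.C (r ^ 2) - ∑ i, (MvPolynomial.X i - MvPolynomial.C (z i)) ^ 2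

lemma ev_sP {n : ℕ} (z : En n) (r : ℝ) (x : En n) : ev x (sP z r) = r ^ 2 - ‖x - z‖ ^ 2 := by
  rw [EuclideanSpace.real_norm_sq_eq]
  simp [sP, ev_C, ev_X]

lemma pderiv_sP {n : ℕ} (z : En n) (r : ℝ) (i : Fin n) : MvPolynomial.pderiv i (sP z r) =
    MvPolynomial.C (-2) * (MvPolynomial.X i - MvPolynomial.C (z i)) := by
  have hX : ∀ k : Fin n, MvPolynomial.pderiv i (MvPolynomial.X k : Pol n)
            = MvPolynomial.C (if i = k then 1 else 0) := by
    intro k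
    split_ifs with h
    · subst h; simp
    · rw [MvPolynomial.pderiv_X_of_ne (Ne.symm h)]; simp
  rw [sP, map_sub, MvPolynomial.pderiv_C, map_sum, Finset.sum_eq_single i]
  · simp
    left; exact (map_ofNat MvPolynomial.C 2).symm
  · intro b _ hb
    simp [MvPolynomial.pderiv_X_of_ne hb]
  · simp

lemma Lop_add {n : ℕ} (a : Matrix (Fin n) (Fin n) ℝ) (p q : Pol n) :
    Lop a (p + q) = Lop a p + Lop a q := by
  simp [Lop, mul_add, Finset.sum_add_distrib]

lemma Lop_sub {n : ℕ} (a : Matrix (Fin n) (Fin n) ℝ) (p q : Pol n) :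
    Lop a (p - q) = Lop a p - Lop a q := by
  simp [Lop, mul_sub, Finset.sum_sub_distrib]

lemma Lop_C_mul {n : ℕ} (a : Matrix (Fin n) (Fin n) ℝ) (c : ℝ) (q : Pol n) :
    Lop a (MvPolynomial.C c * q) = MvPolynomial.C c * Lop a q := by
  simp only [Lop, MvPolynomial.pderiv_C_mul, Finset.mul_sum]
  refine Finset.sum_congr rfl fun i _ => Finset.sum_congr rfl fun j _ => ?_
  ring

lemma Lop_C {n : ℕ} (a : Matrix (Fin n) (Fin n) ℝ) (c : ℝ) : Lop a (MvPolynomial.C c) = 0 := by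
  simp [Lop]

lemma Lop_sP {n : ℕ} (a : Matrix (Fin n) (Fin n) ℝ) (z : En n) (r : ℝ) :
    Lop a (sP z r) = MvPolynomial.C (-2 * ∑ i, a i i) := by
  have : ∀ i j : Fin n, MvPolynomial.pderiv i (MvPolynomial.pderiv j (sP z r)) =
      MvPolynomial.C (if i = j then -2 else 0) := by
    intro i j
    rw [pderiv_sP, MvPolynomial.pderiv_C_mul, map_sub, MvPolynomial.pderiv_C]
    split_ifs with h
    · subst h; simp
    · rw [MvPolynomial.pderiv_X_of_ne (Ne.symm h)]; simp
  simp only [Lop, this, ← map_mul, ← map_sum]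
  congr 1
  simp [Finset.mul_sum, mul_comm]

def Gam {n : ℕ} (a : Matrix (Fin n) (Fin n) ℝ) (p q : Pol n) : Pol n :=
  ∑ i, ∑ j, MvPolynomial.C (a i j) * (MvPolynomial.pderiv i p * MvPolynomial.pderiv j q)

lemma Gam_comm {n : ℕ} {a : Matrix (Fin n) (Fin n) ℝ} (ha : ∀ i j, a i j = a j i) (p q : Pol n) :
    Gam a p q = Gam a q p := by
  rw [Gam, Gam, Finset.sum_comm]
  refine Finset.sum_congr rfl fun i _ => Finset.sum_congr rfl fun j _ => ?_
  rw [ha j i]; ring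

lemma Lop_mul {n : ℕ} {a : Matrix (Fin n) (Fin n) ℝ} (ha : ∀ i j, a i j = a j i) (p q : Pol n) :
    Lop a (p * q) = p * Lop a q + q * Lop a p + 2 * Gam a p q := by
  have : Lop a (p * q) = p * Lop a q + q * Lop a p + Gam a p q + Gam a q p := by
    simp only [Lop, Gam, Finset.mul_sum, ← Finset.sum_add_distrib]
    refine Finset.sum_congr rfl fun i _ => Finset.sum_congr rfl fun j _ => ?_
    simp only [MvPolynomial.pderiv_mul, map_add]
    ring
  rw [this, Gam_comm ha q p]; ring

lemma psd_of_local {n : ℕ} {c : ℝ} {b : En n} {A : Matrix (Fin n) (Fin n) ℝ} (hA : A.IsSymm)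
    {x : En n} (h : IsLocalMin (quadPoly c b A) x) (y : En n) : 0 ≤ QF A y := by
  have c1 : Tendsto (fun t : ℝ => x + t • y) (nhds 0) (nhds x) := by
    have : Continuous fun t : ℝ => x + t • y := by fun_prop
    simpa using this.tendsto 0
  have c2 : Tendsto (fun t : ℝ => x + (-t) • y) (nhds 0) (nhds x) := by
    have : Continuous fun t : ℝ => x + (-t) • y := by fun_prop
    simpa using this.tendsto 0
  have := (c1.eventually h).and (c2.eventually h)
  have h2 : ∀ᶠ t in nhdsWithin (0 : ℝ) {0}ᶜ, 0 ≤ QF A y := by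
    filter_upwards [nhdsWithin_le_nhds this, self_mem_nhdsWithin] with t ht ht0
    obtain ⟨h1, h2⟩ := ht
    rw [quad_shift _ _ _ hA] at h1 h2
    have e : ∀ s : ℝ, QF A (s • y) = s ^ 2 * QF A y := by
      intro s
      simp only [QF, Finset.mul_sum]
      refine Finset.sum_congr rfl fun i _ => Finset.sum_congr rfl fun j _ => ?_
      simp; ring
    have e2 : ∀ s : ℝ, ∑ i, (b i + ∑ j, A i j * x j) * (s • y) i
        = s * ∑ i, (b i + ∑ j, A i j * x j) * y i := by
      intro s
      simp only [Finset.mul_sum (a := s)]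
      refine Finset.sum_congr rfl fun i _ => ?_
      simp; ring
    rw [e, e2] at h1 h2
    have : 0 ≤ t ^ 2 * QF A y := by nlinarith
    have ht2 : 0 < t ^ 2 := by
      have : t ≠ 0 := ht0
      positivity
    exact nonneg_of_mul_nonneg_right this ht2
  exact h2.exists.choose_spec

lemma psd_of_QF {n : ℕ} {A : Matrix (Fin n) (Fin n) ℝ} (hA : A.IsSymm)
    (h : ∀ y : En n, 0 ≤ QF A y) : A.PosSemidef := by
  apply Matrix.PosSemidef.of_dotProduct_mulVec_nonneg
  · rw [Matrix.IsHermitian, Matrix.conjTranspose_eq_transpose_of_trivial]; exact hA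
  · intro x
    have := h (WithLp.toLp 2 x)
    simp only [QF] at this
    have e : star x ⬝ᵥ (A.mulVec x) = ∑ i, ∑ j, A i j * x i * x j := by
      simp only [dotProduct, Matrix.mulVec, Finset.mul_sum]
      refine Finset.sum_congr rfl fun i _ => Finset.sum_congr rfl fun j _ => ?_
      simp; ring
    rw [e]; exact this

lemma ViSub_of_zero_min {n : ℕ} {a : Matrix (Fin n) (Fin n) ℝ} {lam : ℝ} (ha : Coef a lam)
    {U : En n → ℝ} (hU : ∀ x, 0 ≤ U x) {x : En n} (hx : U x = 0) : ViSub a U 0 x := by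
  intro c0 b A hA h
  apply ha.pos
  apply psd_of_QF hA
  apply psd_of_local hA (c := c0) (b := b) (x := x)
  filter_upwards [h] with y hy
  have := hU y
  rw [hx] at hy
  linarith

lemma ViSup.neg {n : ℕ} {a : Matrix (Fin n) (Fin n) ℝ} {U : En n → ℝ} {c : ℝ} {x : En n}
    (h : ViSup a U c x) : ViSub a (fun y => - U y) (-c) x := by
  intro c0 b A hA hm
  have h1 := h (-c0) (-b) ((-1 : ℝ) • A) (hA.smul _) (by
    filter_upwards [hm] with y hy
    have e : ∀ y, quadPoly (-c0) (-b) ((-1 : ℝ) • A) y = - quadPoly c0 b A y := by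
      intro y
      simp [quadPoly, Finset.sum_neg_distrib]; ring
    rw [e, e]
    linarith)
  rw [LA_smul] at h1
  linarith

lemma Coef.T_pos {n : ℕ} [NeZero n] {a : Matrix (Fin n) (Fin n) ℝ} {lam : ℝ} (ha : Coef a lam) :
    (∀ i, 0 < a i i) ∧ 0 < ∑ i, a i i := by
  have h : ∀ i, 0 < a i i := by
    intro i
    have := ha.low (Pi.single i 1)
    have e : ∑ k, (Pi.single i (1 : ℝ) : Fin n → ℝ) k ^ 2 = 1 := by
      rw [Finset.sum_eq_single i] <;> simp +contextual [Pi.single_apply]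
    have e2 : ∑ k, ∑ l, a k l * (Pi.single i (1 : ℝ) : Fin n → ℝ) k
        * (Pi.single i (1 : ℝ) : Fin n → ℝ) l = a i i := by
      rw [Finset.sum_eq_single i, Finset.sum_eq_single i] <;> simp +contextual [Pi.single_apply]
    rw [e, e2] at this
    linarith [ha.lam_pos]
  exact ⟨h, Finset.sum_pos (fun i _ => h i) ⟨0, Finset.mem_univ _⟩⟩

lemma cmp_sub {n : ℕ} [NeZero n] {a : Matrix (Fin n) (Fin n) ℝ} {lam : ℝ} (ha : Coef a lam)
    {U : En n → ℝ} {c : ℝ} {z : En n} {r : ℝ} (hr : 0 < r)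
    (hU : ContinuousOn U (closedBall z r)) (h : ∀ x ∈ ball z r, ViSub a U c x) (q : Pol n)
    (hq : ∀ x ∈ ball z r, ev x (Lop a q) ≤ c) (hs : ∀ x ∈ sphere z r, U x ≤ ev x q) :
    ∀ x ∈ closedBall z r, U x ≤ ev x q := by
  intro x hx
  have hT := ha.T_pos.2
  apply le_of_forall_pos_le_add
  intro δ hδ
  set ε := δ / r ^ 2 with hε
  have hε0 : 0 < ε := by positivity
  set q' := q + MvPolynomial.C ε * sP z r with hq'
  have eq' : ∀ y, ev y q' = ev y q + ε * (r ^ 2 - ‖y - z‖ ^ 2) := by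
    intro y; simp [hq', ev_sP, ev_C]
  have hcont : ContinuousOn (fun y => U y - ev y q') (closedBall z r) :=
    hU.sub (ev_continuous q').continuousOn
  obtain ⟨x1, hx1, hmax⟩ := (isCompact_closedBall z r).exists_isMaxOn ⟨x, hx⟩ hcont
  have hle : U x1 - ev x1 q' ≤ 0 := by
    by_cases hb : x1 ∈ ball z r
    · exfalso
      have hl : IsLocalMax (fun y => U y - ev y q') x1 :=
        hmax.isLocalMax (mem_of_superset (isOpen_ball.mem_nhds hb) ball_subset_closedBall)
      have := touch (h x1 hb) q' hl
      rw [hq', Lop_add, Lop_C_mul, Lop_sP, map_add, map_mul, ev_C, ev_C] at this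
      have := hq x1 hb
      nlinarith [mul_pos hε0 hT]
    · have : x1 ∈ sphere z r := by
        rw [mem_sphere]; rw [mem_closedBall] at hx1; rw [mem_ball] at hb; linarith
      have h1 := hs x1 this
      rw [mem_sphere, dist_eq_norm] at this
      rw [eq', this]; linarith
  have := hmax hx
  simp only [mem_ofPred_eq] at this
  rw [eq' x] at this
  have h3 : ε * (r ^ 2 - ‖x - z‖ ^ 2) ≤ δ := by
    calc _ ≤ ε * r ^ 2 := by gcongr; linarith [sq_nonneg ‖x - z‖]
      _ = δ := by rw [hε]; field_simp
  linarith

lemma cmp_sup {n : ℕ} [NeZero n] {a : Matrix (Fin n) (Fin n) ℝ} {lam : ℝ} (ha : Coef a lam)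
    {U : En n → ℝ} {c : ℝ} {z : En n} {r : ℝ} (hr : 0 < r)
    (hU : ContinuousOn U (closedBall z r)) (h : ∀ x ∈ ball z r, ViSup a U c x) (q : Pol n)
    (hq : ∀ x ∈ ball z r, c ≤ ev x (Lop a q)) (hs : ∀ x ∈ sphere z r, ev x q ≤ U x) :
    ∀ x ∈ closedBall z r, ev x q ≤ U x := by
  intro x hx
  have := cmp_sub ha hr (U := fun y => - U y) hU.neg (fun x hx => (h x hx).neg) (MvPolynomial.C (-1) * q)
    (fun x hx => by rw [Lop_C_mul, map_mul, ev_C]; linarith [hq x hx])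
    (fun x hx => by rw [map_mul, ev_C]; linarith [hs x hx]) x hx
  rw [map_mul, ev_C] at this
  linarith

lemma pol_max {n : ℕ} [NeZero n] {a : Matrix (Fin n) (Fin n) ℝ} {lam : ℝ} (ha : Coef a lam)
    {z : En n} {r : ℝ} (hr : 0 < r) (q : Pol n) (m : ℝ)
    (hq : ∀ x ∈ ball z r, 0 ≤ ev x (Lop a q)) (hs : ∀ x ∈ sphere z r, ev x q ≤ m) :
    ∀ x ∈ closedBall z r, ev x q ≤ m := by
  intro x hx
  have := cmp_sub ha hr (U := fun _ => 0) (c := 0) continuousOn_const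
    (fun x _ => ViSub_of_zero_min ha (fun _ => le_rfl) rfl) (MvPolynomial.C m - q)
    (fun x hx => by rw [Lop_sub, Lop_C]; simpa using hq x hx)
    (fun x hx => by rw [map_sub, ev_C]; linarith [hs x hx]) x hx
  rw [map_sub, ev_C] at this
  linarith

lemma totalDegree_pderiv_le' {n : ℕ} (p : Pol n) (i : Fin n) (d : ℕ) (h : p.totalDegree ≤ d + 1) :
    (MvPolynomial.pderiv i p).totalDegree ≤ d := by
  rw [MvPolynomial.totalDegree, Finset.sup_le_iff]
  intro m hm
  rw [MvPolynomial.mem_support_iff, MvPolynomial.coeff_pderiv] at hm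
  have h1 : m + Finsupp.single i 1 ∈ p.support := by
    rw [MvPolynomial.mem_support_iff]
    intro h0; simp [h0] at hm
  have h2 := (MvPolynomial.le_totalDegree h1).trans h
  rw [Finsupp.sum_add_index' (by simp) (by simp)] at h2
  simp at h2
  exact h2

lemma Lop_degree {n : ℕ} (a : Matrix (Fin n) (Fin n) ℝ) (p : Pol n) (d : ℕ)
    (h : p.totalDegree ≤ d + 2) : (Lop a p).totalDegree ≤ d := by
  refine MvPolynomial.totalDegree_finsetSum_le fun i _ => ?_
  refine MvPolynomial.totalDegree_finsetSum_le fun j _ => ?_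
  refine (MvPolynomial.totalDegree_mul _ _).trans ?_
  rw [MvPolynomial.totalDegree_C, zero_add]
  exact totalDegree_pderiv_le' _ _ _ (totalDegree_pderiv_le' _ _ _ h)

lemma sP_degree {n : ℕ} (z : En n) (r : ℝ) : (sP z r).totalDegree ≤ 2 := by
  refine (MvPolynomial.totalDegree_sub _ _).trans (max_le ?_ ?_)
  · rw [MvPolynomial.totalDegree_C]; omega
  · refine MvPolynomial.totalDegree_finsetSum_le fun i _ => ?_
    refine (MvPolynomial.totalDegree_pow _ _).trans ?_
    have : (MvPolynomial.X i - MvPolynomial.C (z i) : Pol n).totalDegree ≤ 1 :=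
      (MvPolynomial.totalDegree_sub _ _).trans (max_le (by simp) (by simp))
    omega

lemma pol_eq_zero {n : ℕ} (q : Pol n) (z : En n) (r : ℝ) (hr : 0 < r)
    (h : ∀ x ∈ ball z r, ev x q = 0) : q = 0 := by
  obtain ⟨δ, hδ, hδb⟩ : ∃ δ > 0, ∀ v : Fin n → ℝ, (∀ i, |v i - z i| < δ) →
      WithLp.toLp 2 v ∈ ball z r := by
    have hc : Continuous fun v : Fin n → ℝ => (WithLp.toLp 2 v : En n) := by fun_prop
    have := (hc.continuousAt (x := fun i => z i)).preimage_mem_nhds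
      (Metric.ball_mem_nhds z hr)
    obtain ⟨δ, hδ, hb⟩ := Metric.mem_nhds_iff.1 this
    refine ⟨δ, hδ, fun v hv => hb ?_⟩
    rw [mem_ball, dist_pi_lt_iff hδ]
    exact fun i => hv i
  refine MvPolynomial.funext_set (fun i => Ioo (z i - δ) (z i + δ))
    (fun i => Ioo_infinite (by linarith)) fun v hv => ?_
  have := h (WithLp.toLp 2 v) (hδb v fun i => by
    have := hv i (mem_univ i)
    rw [abs_lt]; constructor <;> linarith [this.1, this.2])
  simpa [ev] using this

lemma dirichlet {n : ℕ} [NeZero n] {a : Matrix (Fin n) (Fin n) ℝ} {lam : ℝ} (ha : Coef a lam)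
    (g : Pol n) (c : ℝ) (z : En n) (r : ℝ) (hr : 0 < r) :
    ∃ q : Pol n, Lop a q = MvPolynomial.C c ∧ ∀ x ∈ sphere z r, ev x q = ev x g := by
  set V := MvPolynomial.restrictTotalDegree (Fin n) ℝ g.totalDegree with hV
  let Φ₀ : Pol n →ₗ[ℝ] Pol n :=
    { toFun := fun k => Lop a (sP z r * k)
      map_add' := fun k l => by rw [mul_add, Lop_add]
      map_smul' := fun t k => by
        rw [MvPolynomial.smul_eq_C_mul, MvPolynomial.smul_eq_C_mul, mul_left_comm, Lop_C_mul]
        rfl }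
  have hmaps : ∀ k ∈ V, Φ₀ k ∈ V := by
    intro k hk
    rw [hV, MvPolynomial.mem_restrictTotalDegree] at hk ⊢
    refine Lop_degree _ _ _ ((MvPolynomial.totalDegree_mul _ _).trans ?_)
    have := sP_degree z r
    omega
  let Φ := Φ₀.restrict hmaps
  have hinj : Function.Injective Φ := by
    rw [injective_iff_map_eq_zero]
    intro k hk
    have hk0 : Lop a (sP z r * k) = 0 := congrArg Subtype.val hk
    have h1 := pol_max ha hr (sP z r * k) 0 (fun x _ => by simp [hk0]) (fun x hx => by
      rw [mem_sphere, dist_eq_norm] at hx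
      rw [map_mul, ev_sP, hx]; simp)
    have h2 := pol_max ha hr (MvPolynomial.C (-1) * (sP z r * (k : Pol n))) 0
      (fun x _ => by rw [Lop_C_mul, hk0]; simp) (fun x hx => by
      rw [mem_sphere, dist_eq_norm] at hx
      rw [map_mul, map_mul, ev_sP, hx]; simp)
    have : (k : Pol n) = 0 := by
      refine pol_eq_zero _ z r hr fun x hx => ?_
      have h3 := h1 x (ball_subset_closedBall hx)
      have h4 := h2 x (ball_subset_closedBall hx)
      rw [map_mul, ev_C] at h4
      have h5 : ev x (sP z r * k) = 0 := by linarith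
      rw [map_mul, ev_sP] at h5
      rw [mem_ball, dist_eq_norm] at hx
      rcases mul_eq_zero.1 h5 with h | h
      · have := norm_nonneg (x - z)
        nlinarith
      · exact h
    exact Subtype.ext this
  have hsurj := LinearMap.injective_iff_surjective.1 hinj
  obtain ⟨k, hk⟩ := hsurj ⟨MvPolynomial.C c - Lop a g, by
    rw [hV, MvPolynomial.mem_restrictTotalDegree]
    refine (MvPolynomial.totalDegree_sub _ _).trans (max_le (by simp) ?_)
    exact Lop_degree _ _ _ (by omega)⟩
  have hk0 : Lop a (sP z r * k) = MvPolynomial.C c - Lop a g := congrArg Subtype.val hk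
  refine ⟨g + sP z r * k, by rw [Lop_add, hk0]; ring, fun x hx => ?_⟩
  rw [mem_sphere, dist_eq_norm] at hx
  rw [map_add, map_mul, ev_sP, hx]; simp

lemma weier {n : ℕ} {U : En n → ℝ} (hU : Continuous U) {K : Set (En n)} (hK : IsCompact K)
    {ε : ℝ} (hε : 0 < ε) : ∃ g : Pol n, ∀ x ∈ K, |ev x g - U x| < ε := by
  let co : Fin n → C(En n, ℝ) := fun i => ⟨fun x => x i, by fun_prop⟩
  let φ : Pol n →ₐ[ℝ] C(En n, ℝ) := MvPolynomial.aeval co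
  have hφ : ∀ (g : Pol n) (x : En n), φ g x = ev x g := by
    intro g x
    induction g using MvPolynomial.induction_on with
    | C c => simp [φ, ev_C]
    | add p q hp hq => simp [hp, hq]
    | mul_X p k hp => simp [hp, ev_X]; left; simp [φ, co]
  have hsep : φ.range.SeparatesPoints := by
    intro x y hxy
    obtain ⟨i, hi⟩ : ∃ i, x i ≠ y i := by
      by_contra hcon
      push Not at hcon
      exact hxy (PiLp.ext hcon)
    refine ⟨φ (MvPolynomial.X i), ⟨φ (MvPolynomial.X i), ⟨_, rfl⟩, rfl⟩, ?_⟩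
    rw [hφ, hφ, ev_X, ev_X]; exact hi
  obtain ⟨g, ⟨p, rfl⟩, hg⟩ :=
    ContinuousMap.exists_mem_subalgebra_near_continuous_of_isCompact_of_separatesPoints hsep
      ⟨U, hU⟩ hK hε
  refine ⟨p, fun x hx => ?_⟩
  have := hg x hx
  rw [Real.norm_eq_abs] at this
  rw [← hφ]; exact this

lemma approx {n : ℕ} [NeZero n] {a : Matrix (Fin n) (Fin n) ℝ} {lam : ℝ} (ha : Coef a lam)
    {U : En n → ℝ} (hU : Continuous U) (c : ℝ) (z : En n) {r : ℝ} (hr : 0 < r)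
    {ε : ℝ} (hε : 0 < ε) :
    ∃ q : Pol n, Lop a q = MvPolynomial.C c ∧ ∀ x ∈ sphere z r, |ev x q - U x| < ε := by
  obtain ⟨g, hg⟩ := weier hU (isCompact_sphere z r) hε
  obtain ⟨q, hq, hqs⟩ := dirichlet ha g c z r hr
  exact ⟨q, hq, fun x hx => by rw [hqs x hx]; exact hg x hx⟩


lemma Lop_pderiv {n : ℕ} (a : Matrix (Fin n) (Fin n) ℝ) (q : Pol n) (k : Fin n) :
    Lop a (MvPolynomial.pderiv k q) = MvPolynomial.pderiv k (Lop a q) := by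
  simp only [Lop, map_sum, MvPolynomial.pderiv_C_mul]
  refine Finset.sum_congr rfl fun i _ => Finset.sum_congr rfl fun j _ => ?_
  rw [pderiv_swap j k, pderiv_swap i k]

lemma Gam_sq {n : ℕ} (a : Matrix (Fin n) (Fin n) ℝ) (s p : Pol n) :
    Gam a (s * s) (p * p) = 4 * s * p * Gam a s p := by
  simp only [Gam, Finset.mul_sum, MvPolynomial.pderiv_mul]
  refine Finset.sum_congr rfl fun i _ => Finset.sum_congr rfl fun j _ => ?_
  ring

lemma ev_Gam {n : ℕ} (a : Matrix (Fin n) (Fin n) ℝ) (p q : Pol n) (x : En n) :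
    ev x (Gam a p q) = ∑ i, ∑ j, a i j * ev x (MvPolynomial.pderiv i p) *
      ev x (MvPolynomial.pderiv j q) := by
  simp [Gam, map_sum, ev_C, mul_assoc]

lemma bern_calc {n : ℕ} {a : Matrix (Fin n) (Fin n) ℝ} (ha : ∀ i j, a i j = a j i)
    (s p q : Pol n) (μ : ℝ) (x : En n) (hp : Lop a p = 0) (hq : Lop a q = 0) :
    ev x (Lop a (s * s * (p * p) + MvPolynomial.C μ * (q * q))) =
      2 * ev x s ^ 2 * ev x (Gam a p p) + ev x p ^ 2 * (2 * ev x s * ev x (Lop a s)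
        + 2 * ev x (Gam a s s)) + 8 * ev x s * ev x p * ev x (Gam a s p)
        + 2 * μ * ev x (Gam a q q) := by
  rw [Lop_add, Lop_C_mul, Lop_mul ha (s * s), Lop_mul ha s s, Lop_mul ha p p, Lop_mul ha q q,
    Gam_sq, hp, hq]
  simp only [map_add, map_mul, ev_C, map_zero, map_ofNat]
  ring

lemma Gam_nonneg {n : ℕ} {a : Matrix (Fin n) (Fin n) ℝ} {lam : ℝ} (ha : Coef a lam)
    (s : Pol n) (x : En n) : 0 ≤ ev x (Gam a s s) := by
  have h := ha.low (fun i => ev x (MvPolynomial.pderiv i s))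
  have hl := ha.lam_pos
  rw [ev_Gam]
  refine le_trans ?_ h
  exact mul_nonneg hl.le (Finset.sum_nonneg fun i _ => sq_nonneg _)

lemma Gam_low {n : ℕ} {a : Matrix (Fin n) (Fin n) ℝ} {lam : ℝ} (ha : Coef a lam)
    (q : Pol n) (x : En n) (k : Fin n) :
    lam * ev x (MvPolynomial.pderiv k q) ^ 2 ≤ ev x (Gam a q q) := by
  have h := ha.low (fun i => ev x (MvPolynomial.pderiv i q))
  rw [ev_Gam]
  refine le_trans ?_ h
  refine mul_le_mul_of_nonneg_left ?_ ha.lam_pos.le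
  exact Finset.single_le_sum (f := fun i => ev x (MvPolynomial.pderiv i q) ^ 2)
    (fun i _ => sq_nonneg _) (Finset.mem_univ k)

lemma Gam_cs {n : ℕ} {a : Matrix (Fin n) (Fin n) ℝ} {lam : ℝ} (ha : Coef a lam)
    (s p : Pol n) (x : En n) (σ π : ℝ) : 0 ≤ σ ^ 2 * ev x (Gam a p p)
      + 4 * σ * π * ev x (Gam a s p) + 4 * π ^ 2 * ev x (Gam a s s) := by
  have h1 := Gam_nonneg ha (MvPolynomial.C σ * p + MvPolynomial.C (2 * π) * s) x
  refine h1.trans_eq ?_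
  have h3 : 4 * σ * π * ev x (Gam a s p) =
      2 * σ * π * ev x (Gam a s p) + 2 * σ * π * ev x (Gam a p s) := by
    rw [Gam_comm ha.symm p s]; ring
  rw [h3]
  simp only [ev_Gam, Finset.mul_sum, ← Finset.sum_add_distrib]
  refine Finset.sum_congr rfl fun i _ => Finset.sum_congr rfl fun j _ => ?_
  simp only [map_add, MvPolynomial.pderiv_C_mul]
  simp only [map_mul (ev x), ev_C]
  ring

set_option maxHeartbeats 1000000 in
lemma grad_est {n : ℕ} [NeZero n] {a : Matrix (Fin n) (Fin n) ℝ} {lam : ℝ} (ha : Coef a lam) :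
    ∃ K : ℝ, 0 ≤ K ∧ ∀ (z : En n) (r : ℝ) (q : Pol n) (S : ℝ), 0 < r → Lop a q = 0 →
      (∀ x ∈ closedBall z r, |ev x q| ≤ S) → ∀ i, |ev z (MvPolynomial.pderiv i q)| ≤ K * S / r := by
  set T := ∑ i, a i i with hT
  have hT0 : 0 < T := ha.T_pos.2
  set Ka := ∑ i, ∑ j, |a i j| with hKa
  have hKa0 : 0 ≤ Ka := by positivity
  set C0 := 4 * T + 24 * Ka with hC0
  have hlam := ha.lam_pos
  refine ⟨Real.sqrt (C0 / (2 * lam)), Real.sqrt_nonneg _, fun z r q S hr hq hS k => ?_⟩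
  have hS0 : 0 ≤ S := (abs_nonneg _).trans (hS z (mem_closedBall_self hr.le))
  set p := MvPolynomial.pderiv k q with hp
  have hLp : Lop a p = 0 := by rw [hp, Lop_pderiv, hq, map_zero]
  set μ := C0 * r ^ 2 / (2 * lam) with hμ
  have hμ0 : 0 ≤ μ := by positivity
  set s := sP z r with hs
  have key := pol_max ha hr (s * s * (p * p) + MvPolynomial.C μ * (q * q)) (μ * S ^ 2)
    (fun x hx => by
      rw [bern_calc ha.symm _ _ _ _ _ hLp hq]
      have hsx : ev x s = r ^ 2 - ‖x - z‖ ^ 2 := ev_sP z r x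
      have hxr : ‖x - z‖ ≤ r := by
        rw [← dist_eq_norm]; exact (mem_ball.1 hx).le
      have hn0 := norm_nonneg (x - z)
      have hs0 : 0 ≤ ev x s := by rw [hsx]; nlinarith
      have hs1 : ev x s ≤ r ^ 2 := by rw [hsx]; nlinarith
      have hLs : ev x (Lop a s) = -2 * T := by rw [hs, Lop_sP, ev_C]
      have hGss : ev x (Gam a s s) ≤ 4 * Ka * r ^ 2 := by
        have h1 := QF_abs_le a (x - z)
        have : ev x (Gam a s s) = 4 * QF a (x - z) := by
          rw [ev_Gam, QF, Finset.mul_sum]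
          refine Finset.sum_congr rfl fun i _ => ?_
          rw [Finset.mul_sum]
          refine Finset.sum_congr rfl fun j _ => ?_
          simp only [hs, pderiv_sP, map_mul, map_sub, ev_C, ev_X, PiLp.sub_apply]
          ring
        rw [this]
        have h2 : Ka * ‖x - z‖ ^ 2 ≤ Ka * r ^ 2 := by gcongr
        have := le_abs_self (QF a (x - z))
        linarith
      have hGss0 : 0 ≤ ev x (Gam a s s) := Gam_nonneg ha s x
      have hcs := Gam_cs ha s p x (ev x s) (ev x p)
      have hGqq : lam * ev x p ^ 2 ≤ ev x (Gam a q q) := Gam_low ha q x k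
      have h5 : C0 * r ^ 2 * ev x p ^ 2 ≤ 2 * μ * ev x (Gam a q q) := by
        calc C0 * r ^ 2 * ev x p ^ 2 = 2 * μ * (lam * ev x p ^ 2) := by rw [hμ]; field_simp
          _ ≤ _ := by gcongr
      have h6 : -(C0 * r ^ 2) ≤ 2 * ev x s * ev x (Lop a s) - 6 * ev x (Gam a s s) := by
        rw [hLs, hC0]
        nlinarith
      have h7 : -(C0 * r ^ 2) * ev x p ^ 2 ≤
        (2 * ev x s * ev x (Lop a s) - 6 * ev x (Gam a s s)) * ev x p ^ 2 := by gcongr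
      linarith)
    (fun x hx => by
      have hq2 := hS x (sphere_subset_closedBall hx)
      rw [mem_sphere, dist_eq_norm] at hx
      simp only [map_add, map_mul, ev_C, hs, ev_sP, hx]
      have : ev x q * ev x q ≤ S ^ 2 := by
        rw [← abs_mul_abs_self (ev x q), ← pow_two]; gcongr
      nlinarith) z (mem_closedBall_self hr.le)
  simp only [map_add, map_mul, ev_C, hs, ev_sP] at key
  simp only [sub_self, norm_zero] at key
  have h1 : (ev z p) ^ 2 ≤ C0 / (2 * lam) * S ^ 2 / r ^ 2 := by
    rw [le_div_iff₀ (by positivity)]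
    have h2 : r ^ 2 * (ev z p ^ 2 * r ^ 2) ≤ r ^ 2 * (C0 / (2 * lam) * S ^ 2) := by
      have : μ * S ^ 2 = r ^ 2 * (C0 / (2 * lam) * S ^ 2) := by rw [hμ]; ring
      rw [← this]
      nlinarith [mul_nonneg hμ0 (mul_self_nonneg (ev z q))]
    exact le_of_mul_le_mul_left h2 (by positivity)
  apply abs_le_of_sq_le_sq _ (by positivity)
  rw [div_pow, mul_pow, Real.sq_sqrt (by positivity)]
  exact h1

lemma ev_hasDeriv {n : ℕ} (q : Pol n) (z k : En n) (t : ℝ) :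
    HasDerivAt (fun t : ℝ => ev (z + t • k) q)
      (∑ i, k i * ev (z + t • k) (MvPolynomial.pderiv i q)) t := by
  induction q using MvPolynomial.induction_on with
  | C c => simpa [ev_C] using hasDerivAt_const t c
  | add p q hp hq =>
    simp only [map_add, mul_add, Finset.sum_add_distrib]
    exact hp.add hq
  | mul_X p m hp =>
    have h1 : HasDerivAt (fun t : ℝ => (z + t • k) m) (k m) t := by
      have : HasDerivAt (fun t : ℝ => z m + t * k m) (1 * k m) t :=
        ((hasDerivAt_id t).mul_const (k m)).const_add (z m)
      simpa using this
    have h2 := hp.mul h1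
    have e : ∑ i, k i * ev (z + t • k) (MvPolynomial.pderiv i (p * MvPolynomial.X m)) =
        (∑ i, k i * ev (z + t • k) (MvPolynomial.pderiv i p)) * (z + t • k) m
        + ev (z + t • k) p * k m := by
      have : ∀ i, k i * ev (z + t • k) (MvPolynomial.pderiv i (p * MvPolynomial.X m)) =
        (k i * ev (z + t • k) (MvPolynomial.pderiv i p)) * (z + t • k) m
          + if i = m then ev (z + t • k) p * k m else 0 := by
        intro i
        rw [MvPolynomial.pderiv_mul, map_add, map_mul, map_mul, ev_X]
        split_ifs with h
        · subst h; simp; ring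
        · rw [MvPolynomial.pderiv_X_of_ne (Ne.symm h)]; simp; ring
      simp only [this, Finset.sum_add_distrib, Finset.sum_mul]
      simp
    rw [e]
    simp only [map_mul, ev_X]
    exact h2

lemma rem_est {n : ℕ} [NeZero n] {a : Matrix (Fin n) (Fin n) ℝ} {lam : ℝ} (ha : Coef a lam) :
    ∃ K : ℝ, 0 ≤ K ∧ ∀ (z : En n) (r : ℝ) (q : Pol n) (S : ℝ), 0 < r → Lop a q = 0 →
      (∀ x ∈ closedBall z r, |ev x q| ≤ S) → ∀ k : En n, ‖k‖ ≤ r / 2 →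
      |ev (z + k) q - ev z q - ∑ i, k i * ev z (MvPolynomial.pderiv i q)|
        ≤ K * S * ‖k‖ ^ 2 / r ^ 2 := by
  obtain ⟨K, hK, H⟩ := grad_est ha
  refine ⟨n * (n * (16 * K ^ 2)), by positivity, fun z r q S hr hq hS k hk => ?_⟩
  have hS0 : 0 ≤ S := (abs_nonneg _).trans (hS z (mem_closedBall_self hr.le))
  have hL : ∀ j, Lop a (MvPolynomial.pderiv j q) = 0 := fun j => by rw [Lop_pderiv, hq, map_zero]
  set B := 16 * K ^ 2 * S / r ^ 2 with hB
  have hB0 : 0 ≤ B := by positivity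
  have hsec : ∀ t ∈ Icc (0 : ℝ) 1, ∀ i j,
      |ev (z + t • k) (MvPolynomial.pderiv j (MvPolynomial.pderiv i q))| ≤ B := by
    intro t ht i j
    have h1 : ‖t • k‖ ≤ r / 2 := by
      rw [norm_smul, Real.norm_eq_abs, abs_of_nonneg ht.1]
      calc t * ‖k‖ ≤ 1 * ‖k‖ := by gcongr; exact ht.2
        _ ≤ _ := by linarith
    have := H (z + t • k) (r / 4) (MvPolynomial.pderiv i q) (K * S / (r / 4)) (by positivity)
      (hL i) (fun x hx => H x (r / 4) q S (by positivity) hq (fun y hy => hS y (by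
        rw [mem_closedBall] at *
        have h2 : dist (z + t • k) z ≤ r / 2 := by rw [dist_eq_norm]; simpa using h1
        have := dist_triangle y x z
        have := dist_triangle x (z + t • k) z
        linarith)) i) j
    refine this.trans_eq ?_
    rw [hB]; field_simp; ring
  have hlip : ∀ t ∈ Icc (0 : ℝ) 1, ∀ i, |ev (z + t • k) (MvPolynomial.pderiv i q)
      - ev z (MvPolynomial.pderiv i q)| ≤ n * (‖k‖ * B) := by
    intro t ht i
    have := (convex_Icc (0 : ℝ) 1).norm_image_sub_le_of_norm_hasDerivWithin_le
      (f := fun t : ℝ => ev (z + t • k) (MvPolynomial.pderiv i q))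
      (C := n * (‖k‖ * B)) (x := 0) (y := t)
      (fun s _ => (ev_hasDeriv (MvPolynomial.pderiv i q) z k s).hasDerivWithinAt)
      (fun s hs => by
        rw [Real.norm_eq_abs]
        refine (Finset.abs_sum_le_sum_abs _ _).trans ?_
        calc _ ≤ ∑ _j : Fin n, ‖k‖ * B := Finset.sum_le_sum fun j _ => by
              rw [abs_mul]
              have := hsec s hs i j
              have := abs_coord_le k j
              gcongr
          _ = _ := by simp)
      (by simp) ht
    simp only [zero_smul, add_zero, sub_zero, Real.norm_eq_abs] at this
    refine this.trans ?_
    rw [abs_of_nonneg ht.1]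
    have h0 : 0 ≤ n * (‖k‖ * B) := by positivity
    calc _ ≤ n * (‖k‖ * B) * 1 := by gcongr; exact ht.2
      _ = _ := mul_one _
  have := (convex_Icc (0 : ℝ) 1).norm_image_sub_le_of_norm_hasDerivWithin_le
      (f := fun t : ℝ => ev (z + t • k) q - t * ∑ i, k i * ev z (MvPolynomial.pderiv i q))
      (C := n * (‖k‖ * (n * (‖k‖ * B)))) (x := 0) (y := 1)
      (fun s _ => ((ev_hasDeriv q z k s).sub
        ((hasDerivAt_id s).mul_const _)).hasDerivWithinAt)
      (fun s hs => by
        rw [Real.norm_eq_abs, one_mul, ← Finset.sum_sub_distrib]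
        refine (Finset.abs_sum_le_sum_abs _ _).trans ?_
        calc _ ≤ ∑ _j : Fin n, ‖k‖ * (n * (‖k‖ * B)) := Finset.sum_le_sum fun j _ => by
              rw [← mul_sub, abs_mul]
              have := hlip s hs j
              have := abs_coord_le k j
              gcongr
          _ = _ := by simp)
      (by simp) (by simp)
  simp only [zero_smul, add_zero, sub_zero, Real.norm_eq_abs, one_smul, one_mul, zero_mul,
    abs_one, mul_one] at this
  have e : ev (z + k) q - ∑ i, k i * ev z (MvPolynomial.pderiv i q) - ev z q
    = ev (z + k) q - ev z q - ∑ i, k i * ev z (MvPolynomial.pderiv i q) := by ring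
  rw [e] at this
  refine this.trans_eq ?_
  rw [hB]; ring


lemma harm_approx {n : ℕ} [NeZero n] {a : Matrix (Fin n) (Fin n) ℝ} {lam : ℝ} (ha : Coef a lam)
    {U : En n → ℝ} (hU : Continuous U) (h0 : ∀ x, ViSub a U 0 x) (h1 : ∀ x, ViSup a U 1 x) :
    ∃ K : ℝ, 0 ≤ K ∧ ∀ (z : En n) (r : ℝ), 0 < r → ∃ p : Pol n, Lop a p = 0 ∧
      ∀ x ∈ closedBall z r, |U x - ev x p| ≤ K * r ^ 2 := by
  have hT0 := ha.T_pos.2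
  set T := ∑ i, a i i with hT
  refine ⟨1 + 1 / (2 * T), by positivity, fun z r hr => ?_⟩
  obtain ⟨p, hp, hps⟩ := approx ha hU 0 z hr (ε := r ^ 2) (by positivity)
  have hp0 : Lop a p = 0 := by rw [hp]; simp
  refine ⟨p, hp0, fun x hx => ?_⟩
  have u1 := cmp_sub ha hr hU.continuousOn (fun y _ => h0 y) (p + MvPolynomial.C (r ^ 2))
    (fun y _ => by rw [Lop_add, hp0, Lop_C]; simp)
    (fun y hy => by
      have := abs_lt.1 (hps y hy)
      rw [map_add, ev_C]; linarith) x hx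
  have u2 := cmp_sup ha hr hU.continuousOn (fun y _ => h1 y)
    (p - MvPolynomial.C (r ^ 2) - MvPolynomial.C (1 / (2 * T)) * sP z r)
    (fun y _ => by
      rw [Lop_sub, Lop_sub, hp0, Lop_C, Lop_C_mul, Lop_sP, map_sub, map_mul, ev_C, ev_C, ← hT]
      simp; field_simp; simp)
    (fun y hy => by
      have := abs_lt.1 (hps y hy)
      rw [mem_sphere, dist_eq_norm] at hy
      rw [map_sub, map_sub, map_mul, ev_C, ev_C, ev_sP, hy]; linarith) x hx
  rw [map_add, ev_C] at u1
  rw [map_sub, map_sub, map_mul, ev_C, ev_C, ev_sP] at u2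
  have h3 : 1 / (2 * T) * (r ^ 2 - ‖x - z‖ ^ 2) ≤ 1 / (2 * T) * r ^ 2 := by
    gcongr; linarith [sq_nonneg ‖x - z‖]
  have h4 : 0 ≤ 1 / (2 * T) * r ^ 2 := by positivity
  rw [abs_le]
  constructor <;> linarith

def WD {n : ℕ} (f : En n → ℝ) (z k : En n) (t : ℝ) : ℝ :=
  t * f (z + (1 - t) • k) + (1 - t) * f (z + (-t) • k) - f z

lemma WD_bound {n : ℕ} {f : En n → ℝ} {z k : En n} {t S r : ℝ} (ht0 : 0 ≤ t) (ht1 : t ≤ 1)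
    (hk : ‖k‖ ≤ r) (hf : ∀ x ∈ closedBall z r, |f x| ≤ S) : |WD f z k t| ≤ 2 * S := by
  have h1 := hf (z + (1 - t) • k) (by
    rw [mem_closedBall, dist_eq_norm, add_sub_cancel_left, norm_smul, Real.norm_eq_abs,
      abs_of_nonneg (by linarith)]
    nlinarith [norm_nonneg k])
  have h2 := hf (z + (-t) • k) (by
    rw [mem_closedBall, dist_eq_norm, add_sub_cancel_left, norm_smul, Real.norm_eq_abs,
      abs_neg, abs_of_nonneg (by linarith)]
    nlinarith [norm_nonneg k])
  have h3 := hf z (mem_closedBall_self ((norm_nonneg k).trans hk))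
  rw [abs_le] at *
  unfold WD
  constructor <;> nlinarith

lemma WD_pol {n : ℕ} [NeZero n] {a : Matrix (Fin n) (Fin n) ℝ} {lam : ℝ} (ha : Coef a lam) :
    ∃ K : ℝ, 0 ≤ K ∧ ∀ (z : En n) (r : ℝ) (q : Pol n) (S : ℝ), 0 < r → Lop a q = 0 →
      (∀ x ∈ closedBall z r, |ev x q| ≤ S) → ∀ k : En n, ‖k‖ ≤ r / 2 → ∀ t : ℝ, 0 ≤ t → t ≤ 1 →
      |WD (fun x => ev x q) z k t| ≤ K * S * ‖k‖ ^ 2 / r ^ 2 := by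
  obtain ⟨K, hK, H⟩ := rem_est ha
  refine ⟨K, hK, fun z r q S hr hq hS k hk t ht0 ht1 => ?_⟩
  have hS0 : 0 ≤ S := (abs_nonneg _).trans (hS z (mem_closedBall_self hr.le))
  have n1 : ‖(1 - t) • k‖ = (1 - t) * ‖k‖ := by
    rw [norm_smul, Real.norm_eq_abs, abs_of_nonneg (by linarith)]
  have n2 : ‖(-t) • k‖ = t * ‖k‖ := by
    rw [norm_smul, Real.norm_eq_abs, abs_neg, abs_of_nonneg (by linarith)]
  have hk0 := norm_nonneg k
  have h1 := H z r q S hr hq hS ((1 - t) • k) (by rw [n1]; nlinarith)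
  have h2 := H z r q S hr hq hS ((-t) • k) (by rw [n2]; nlinarith)
  rw [n1] at h1
  rw [n2] at h2
  set D := ∑ i, k i * ev z (MvPolynomial.pderiv i q) with hD
  have e : ∀ s : ℝ, ∑ i, (s • k) i * ev z (MvPolynomial.pderiv i q) = s * D := by
    intro s
    rw [hD, Finset.mul_sum]
    refine Finset.sum_congr rfl fun i _ => ?_
    simp; ring
  rw [e] at h1 h2
  set Q := K * S * ‖k‖ ^ 2 / r ^ 2 with hQ
  have hQ0 : 0 ≤ Q := by positivity
  have e1 : K * S * ((1 - t) * ‖k‖) ^ 2 / r ^ 2 = (1 - t) ^ 2 * Q := by rw [hQ]; ring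
  have e2 : K * S * (t * ‖k‖) ^ 2 / r ^ 2 = t ^ 2 * Q := by rw [hQ]; ring
  rw [e1] at h1
  rw [e2] at h2
  have h1' : (1 - t) ^ 2 * Q ≤ Q := mul_le_of_le_one_left hQ0 (by nlinarith)
  have h2' : t ^ 2 * Q ≤ Q := mul_le_of_le_one_left hQ0 (by nlinarith)
  have h1 := h1.trans h1'
  have h2 := h2.trans h2'
  have e3 : WD (fun x => ev x q) z k t = t * (ev (z + (1 - t) • k) q - ev z q - (1 - t) * D)
      + (1 - t) * (ev (z + (-t) • k) q - ev z q - (-t) * D) := by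
    unfold WD; ring
  rw [e3]
  rw [abs_le] at *
  constructor <;> nlinarith

lemma growth_est {n : ℕ} [NeZero n] {a : Matrix (Fin n) (Fin n) ℝ} {lam : ℝ} (ha : Coef a lam)
    {U : En n → ℝ} (hU : Continuous U) (h0 : ∀ x, ViSub a U 0 x) (h1 : ∀ x, ViSup a U 1 x)
    {M : ℝ} (hM : 0 < M) (hg : ∀ x, |U x| ≤ M * (‖x‖ ^ 2 + 1)) (k : En n) :
    ∃ B : ℝ, 0 < B ∧ ∀ (ρ : ℝ) (z : En n) (t : ℝ), 1 ≤ ρ → 2 * ‖k‖ ≤ ρ → ‖z‖ ≤ ρ ^ 3 →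
      0 ≤ t → t ≤ 1 → |WD U z k t| ≤ B * ρ ^ 2 := by
  obtain ⟨K1, hK1, H1⟩ := harm_approx ha hU h0 h1
  obtain ⟨K, hK, H⟩ := WD_pol ha
  refine ⟨2 * K1 + 4 * K * K1 * ‖k‖ ^ 2 + K * (K1 + 5 * M) * ‖k‖ ^ 2 + 1, by positivity,
    fun ρ z t hρ hkρ hz ht0 ht1 => ?_⟩
  have hρ0 : 0 < ρ := by linarith
  have r12 : ρ ≤ ρ ^ 2 := by nlinarith
  have r23 : ρ ^ 2 ≤ ρ ^ 3 := by nlinarith [sq_nonneg ρ]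
  have r24 : ρ ^ 2 ≤ ρ ^ 4 := by nlinarith [sq_nonneg ρ]
  have r46 : ρ ^ 4 ≤ ρ ^ 6 := by nlinarith [sq_nonneg (ρ ^ 2)]
  have r06 : 1 ≤ ρ ^ 6 := one_le_pow₀ hρ
  have r02 : 1 ≤ ρ ^ 2 := one_le_pow₀ hρ
  obtain ⟨p0, l0, e0⟩ := H1 z (ρ ^ 3) (by positivity)
  obtain ⟨p1, l1, e1⟩ := H1 z (ρ ^ 2) (by positivity)
  obtain ⟨p2, l2, e2⟩ := H1 z ρ hρ0
  have b0 := H z (ρ ^ 3) p0 ((K1 + 5 * M) * ρ ^ 6) (by positivity) l0 (fun x hx => by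
    have h := e0 x hx
    have h' := hg x
    have hxn : ‖x‖ ≤ 2 * ρ ^ 3 := by
      rw [mem_closedBall, dist_eq_norm] at hx
      have := norm_le_insert' x z
      linarith
    have hx2 : ‖x‖ ^ 2 ≤ 4 * ρ ^ 6 := by
      calc ‖x‖ ^ 2 ≤ (2 * ρ ^ 3) ^ 2 := by gcongr
        _ = _ := by ring
    have : M * (‖x‖ ^ 2 + 1) ≤ M * (5 * ρ ^ 6) := by gcongr; linarith
    have e6 : (ρ ^ 3) ^ 2 = ρ ^ 6 := by ring
    rw [e6] at h
    rw [abs_le] at *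
    constructor <;> linarith) k (by linarith) t ht0 ht1
  have b1 := H z (ρ ^ 2) (p1 - p0) (2 * K1 * ρ ^ 6) (by positivity) (by rw [Lop_sub, l0, l1, sub_zero])
    (fun x hx => by
      have h := e0 x (closedBall_subset_closedBall r23 hx)
      have h' := e1 x hx
      have e6 : (ρ ^ 3) ^ 2 = ρ ^ 6 := by ring
      have e4 : (ρ ^ 2) ^ 2 = ρ ^ 4 := by ring
      rw [e6] at h
      rw [e4] at h'
      have : K1 * ρ ^ 4 ≤ K1 * ρ ^ 6 := by gcongr
      rw [map_sub]
      rw [abs_le] at *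
      constructor <;> linarith) k (by linarith) t ht0 ht1
  have b2 := H z ρ (p2 - p1) (2 * K1 * ρ ^ 4) (by positivity) (by rw [Lop_sub, l2, l1, sub_zero])
    (fun x hx => by
      have h := e1 x (closedBall_subset_closedBall r12 hx)
      have h' := e2 x hx
      have e4 : (ρ ^ 2) ^ 2 = ρ ^ 4 := by ring
      rw [e4] at h
      have : K1 * ρ ^ 2 ≤ K1 * ρ ^ 4 := by gcongr
      rw [map_sub]
      rw [abs_le] at *
      constructor <;> linarith) k (by linarith) t ht0 ht1
  have b3 := WD_bound (f := fun x => U x - ev x p2) (z := z) (k := k) ht0 ht1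
    (by linarith [norm_nonneg k] : ‖k‖ ≤ ρ) e2
  have c0 : K * ((K1 + 5 * M) * ρ ^ 6) * ‖k‖ ^ 2 / (ρ ^ 3) ^ 2 = K * (K1 + 5 * M) * ‖k‖ ^ 2 := by
    field_simp
  have c1 : K * (2 * K1 * ρ ^ 6) * ‖k‖ ^ 2 / (ρ ^ 2) ^ 2 = 2 * K * K1 * ‖k‖ ^ 2 * ρ ^ 2 := by
    field_simp
  have c2 : K * (2 * K1 * ρ ^ 4) * ‖k‖ ^ 2 / ρ ^ 2 = 2 * K * K1 * ‖k‖ ^ 2 * ρ ^ 2 := by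
    field_simp
  rw [c0] at b0
  rw [c1] at b1
  rw [c2] at b2
  have b0' : K * (K1 + 5 * M) * ‖k‖ ^ 2 ≤ K * (K1 + 5 * M) * ‖k‖ ^ 2 * ρ ^ 2 :=
    le_mul_of_one_le_right (by positivity) r02
  have e : WD U z k t = WD (fun x => U x - ev x p2) z k t + WD (fun x => ev x (p2 - p1)) z k t
      + WD (fun x => ev x (p1 - p0)) z k t + WD (fun x => ev x p0) z k t := by
    simp only [WD, map_sub]; ring
  rw [e]
  rw [abs_le] at *
  constructor <;> nlinarith

lemma ViSup.translate {n : ℕ} {a : Matrix (Fin n) (Fin n) ℝ} {U : En n → ℝ} {c : ℝ} {x v : En n}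
    (h : ViSup a U c (x + v)) : ViSup a (fun y => U (y + v)) c x := by
  intro c0 b A hA hm
  set b' : En n := WithLp.toLp 2 (fun i => b i + ∑ j, A i j * (-v) j) with hb'
  refine h (quadPoly c0 b A (-v)) b' A hA ?_
  have e : ∀ y, quadPoly (quadPoly c0 b A (-v)) b' A y = quadPoly c0 b A (y + -v) := by
    intro y
    rw [add_comm y, quad_shift _ _ _ hA]
    simp [quadPoly, hb', QF]
  have c1 : Tendsto (fun y : En n => y + -v) (nhds (x + v)) (nhds x) := by
    have : Continuous fun y : En n => y + -v := by fun_prop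
    simpa using this.tendsto (x + v)
  filter_upwards [c1.eventually hm] with y hy
  rw [e, e]
  simpa using hy

def bP {n : ℕ} [NeZero n] (κ R : ℝ) : Pol n :=
  MvPolynomial.C 1 - MvPolynomial.C (1 / R ^ 2) * sP 0 R
    + MvPolynomial.C (κ / R) * MvPolynomial.X 0
    - MvPolynomial.C (κ / R ^ 2) * (MvPolynomial.X 0 * MvPolynomial.X 0)

lemma ev_bP {n : ℕ} [NeZero n] (κ R : ℝ) (hR : 0 < R) (x : En n) :
    ev x (bP κ R) = ‖x‖ ^ 2 / R ^ 2 + κ * (x 0 / R) * (1 - x 0 / R) := by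
  simp only [bP, map_add, map_sub, map_mul, ev_C, ev_X, ev_sP, sub_zero]
  field_simp
  ring

lemma Lop_bP {n : ℕ} [NeZero n] {a : Matrix (Fin n) (Fin n) ℝ} {lam : ℝ} (ha : Coef a lam)
    (κ R : ℝ) : Lop a (bP κ R) = MvPolynomial.C ((2 * ∑ i, a i i) / R ^ 2
      - 2 * κ * a 0 0 / R ^ 2) := by
  have hX : Lop a (MvPolynomial.X 0 : Pol n) = 0 := by
    have : ∀ i j : Fin n, MvPolynomial.pderiv i (MvPolynomial.pderiv j
        (MvPolynomial.X 0 : Pol n)) = 0 := by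
      intro i j
      by_cases h : j = 0
      · subst h; simp
      · rw [MvPolynomial.pderiv_X_of_ne (Ne.symm h)]; simp
    simp only [Lop, this, mul_zero, Finset.sum_const_zero]
  have hG : Gam a (MvPolynomial.X 0 : Pol n) (MvPolynomial.X 0) = MvPolynomial.C (a 0 0) := by
    rw [Gam, Finset.sum_eq_single 0, Finset.sum_eq_single 0]
    · simp
    · intro j _ hj
      simp [MvPolynomial.pderiv_X_of_ne hj.symm]
    · simp
    · intro j _ hj
      simp [MvPolynomial.pderiv_X_of_ne hj.symm]
    · simp
  rw [bP, Lop_sub, Lop_add, Lop_sub, Lop_C, Lop_C_mul, Lop_C_mul, Lop_C_mul, Lop_sP,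
    Lop_mul ha.symm, hX, hG, show (2 : Pol n) = MvPolynomial.C 2 from (map_ofNat _ 2).symm]
  simp only [mul_zero, zero_add, add_zero, zero_sub, ← map_mul, ← map_neg, ← map_sub]
  congr 1
  ring

/-- no negative interior minimum of the weighted difference plus a strict barrier -/
lemma no_min {n : ℕ} [NeZero n] {a : Matrix (Fin n) (Fin n) ℝ} {lam : ℝ} (ha : Coef a lam)
    {U : En n → ℝ} (hU : Continuous U) (h1 : ∀ x, ViSup a U 1 x)
    (h2 : ∀ x, 0 < U x → ViSub a U 1 x) (k : En n) {t : ℝ} (ht0 : 0 ≤ t) (ht1 : t ≤ 1)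
    (β : Pol n) (κ : ℝ) (hκ : 0 < κ) (hβ : Lop a β = MvPolynomial.C (-κ)) {y : En n} {δ : ℝ}
    (hδ : 0 < δ) (hpos : ∀ x ∈ closedBall y δ, 0 < U x)
    (hmin : ∀ x ∈ closedBall y δ, WD U y k t + ev y β ≤ WD U x k t + ev x β) : False := by
  have hT0 := ha.T_pos.2
  set T := ∑ i, a i i with hT
  set τ := κ / (2 * T) with hτ
  have hτ0 : 0 < τ := by positivity
  set ε := τ * δ ^ 2 / 8 with hε
  have hε0 : 0 < ε := by positivity
  have cv : ∀ v : En n, Continuous fun x => U (x + v) := fun v => hU.comp (by fun_prop)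
  have low : ∀ v : En n, ∃ p : Pol n, Lop a p = MvPolynomial.C 1 ∧
      (∀ x ∈ sphere y δ, |ev x p - U (x + v)| < ε) ∧ ev y p - ε ≤ U (y + v) := by
    intro v
    obtain ⟨p, hp, hps⟩ := approx ha (cv v) 1 y hδ hε0
    refine ⟨p, hp, hps, ?_⟩
    have := cmp_sup ha hδ (cv v).continuousOn (fun x _ => (h1 (x + v)).translate)
      (p - MvPolynomial.C ε) (fun x _ => by rw [Lop_sub, hp, Lop_C, sub_zero, ev_C])
      (fun x hx => by
        have := abs_lt.1 (hps x hx)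
        rw [map_sub, ev_C]; linarith) y (mem_closedBall_self hδ.le)
    rw [map_sub, ev_C] at this
    exact this
  obtain ⟨p1, l1, s1, i1⟩ := low ((1 - t) • k)
  obtain ⟨p2, l2, s2, i2⟩ := low ((-t) • k)
  obtain ⟨p, l, s⟩ := approx ha hU 1 y hδ hε0
  have i := cmp_sub ha hδ hU.continuousOn (fun x hx => h2 x (hpos x (ball_subset_closedBall hx)))
    (p + MvPolynomial.C ε) (fun x _ => by rw [Lop_add, l, Lop_C, add_zero, ev_C])
    (fun x hx => by
        have := abs_lt.1 (s x hx)
        rw [map_add, ev_C]; linarith) y (mem_closedBall_self hδ.le)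
  rw [map_add, ev_C] at i
  have key := pol_max ha hδ (p - MvPolynomial.C t * p1 - MvPolynomial.C (1 - t) * p2 - β
    + MvPolynomial.C τ * sP y δ) (-(WD U y k t + ev y β) + 2 * ε)
    (fun x _ => by
      rw [Lop_add, Lop_sub, Lop_sub, Lop_sub, Lop_C_mul, Lop_C_mul, Lop_C_mul, l, l1, l2, hβ,
        Lop_sP]
      simp only [map_add, map_sub, map_mul, ev_C]
      rw [← hT]
      have : τ * (-2 * T) = -κ := by rw [hτ]; field_simp
      rw [this]
      linarith)
    (fun x hx => by
      have g1 := abs_lt.1 (s1 x hx)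
      have g2 := abs_lt.1 (s2 x hx)
      have g := abs_lt.1 (s x hx)
      have gm := hmin x (sphere_subset_closedBall hx)
      rw [mem_sphere, dist_eq_norm] at hx
      simp only [map_add, map_sub, map_mul, ev_C, ev_sP, hx]
      have w : WD U x k t = t * U (x + (1 - t) • k) + (1 - t) * U (x + (-t) • k) - U x := rfl
      rw [w] at gm
      nlinarith [g1.1, g1.2, g2.1, g2.2, g.1, g.2]) y (mem_closedBall_self hδ.le)
  simp only [map_add, map_sub, map_mul, ev_C, ev_sP, sub_self, norm_zero] at key
  have w : WD U y k t = t * U (y + (1 - t) • k) + (1 - t) * U (y + (-t) • k) - U y := rfl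
  rw [w] at key
  have f1 : t * (ev y p1 - ε) ≤ t * U (y + (1 - t) • k) := by gcongr
  have f2 : (1 - t) * (ev y p2 - ε) ≤ (1 - t) * U (y + (-t) • k) :=
    mul_le_mul_of_nonneg_left i2 (by linarith)
  have : τ * δ ^ 2 = 8 * ε := by rw [hε]; ring
  nlinarith

lemma lim_arg {W B κ X x0 K : ℝ} (hB : 0 < B) (hκ : 0 < κ) (hx : 0 < x0) (hX : 0 ≤ X) (hK : 0 ≤ K)
    (claim : ∀ ρ : ℝ, 1 ≤ ρ → 2 * K ≤ ρ → X ≤ ρ ^ 3 →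
      0 ≤ W + B * ρ ^ 2 * (X ^ 2 / (ρ ^ 3) ^ 2 + κ * (x0 / ρ ^ 3) * (1 - x0 / ρ ^ 3))) : 0 ≤ W := by
  by_contra hneg
  push Not at hneg
  obtain ⟨D, hD⟩ : ∃ D, D = B * (X ^ 2 + κ * x0) := ⟨_, rfl⟩
  have hD0 : 0 < D := by rw [hD]; positivity
  obtain ⟨w, hw⟩ : ∃ w, w = - W := ⟨_, rfl⟩
  have hw0 : 0 < w := by linarith
  obtain ⟨ρ, hρ⟩ : ∃ ρ, ρ = 1 + 2 * K + X + D / w := ⟨_, rfl⟩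
  have hdw : 0 < D / w := by positivity
  have hρ1 : 1 ≤ ρ := by linarith
  have hρ0 : 0 < ρ := by linarith
  have hρ3 : ρ ≤ ρ ^ 3 := le_self_pow₀ hρ1 (by norm_num)
  have hc := claim ρ hρ1 (by linarith) (by linarith)
  have h31 : 1 ≤ ρ ^ 3 := one_le_pow₀ hρ1
  have g1 : κ * (x0 / ρ ^ 3) * (1 - x0 / ρ ^ 3) ≤ κ * (x0 / ρ ^ 3) := by
    have : 0 ≤ x0 / ρ ^ 3 := by positivity
    exact mul_le_of_le_one_right (by positivity) (by linarith)
  have g2 : X ^ 2 / (ρ ^ 3) ^ 2 ≤ X ^ 2 / ρ ^ 3 :=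
    div_le_div_of_nonneg_left (by positivity) (by positivity) (le_self_pow₀ h31 (by norm_num))
  have g3 : B * ρ ^ 2 * (X ^ 2 / (ρ ^ 3) ^ 2 + κ * (x0 / ρ ^ 3) * (1 - x0 / ρ ^ 3)) ≤
      B * ρ ^ 2 * (X ^ 2 / ρ ^ 3 + κ * (x0 / ρ ^ 3)) :=
    mul_le_mul_of_nonneg_left (add_le_add g2 g1) (by positivity)
  have g4 : B * ρ ^ 2 * (X ^ 2 / ρ ^ 3 + κ * (x0 / ρ ^ 3)) = D / ρ := by
    rw [hD]; field_simp
  have : D / ρ < w := by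
    rw [div_lt_iff₀ hρ0, ← div_lt_iff₀' hw0]
    linarith
  linarith

set_option maxHeartbeats 1000000 in
lemma WD_nonneg {n : ℕ} [NeZero n] {a : Matrix (Fin n) (Fin n) ℝ} {lam : ℝ} (ha : Coef a lam)
    {U : En n → ℝ} (hU : Continuous U) (hU0 : ∀ x, 0 ≤ U x) (hUz : ∀ x : En n, x 0 ≤ 0 → U x = 0)
    (h0 : ∀ x, ViSub a U 0 x) (h1 : ∀ x, ViSup a U 1 x)
    (h2 : ∀ x, 0 < U x → ViSub a U 1 x)
    {M : ℝ} (hM : 0 < M) (hg : ∀ x, |U x| ≤ M * (‖x‖ ^ 2 + 1)) (k : En n) {t : ℝ} (ht0 : 0 ≤ t)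
    (ht1 : t ≤ 1) (x : En n) : 0 ≤ WD U x k t := by
  have hz : ∀ x, U x = 0 → 0 ≤ WD U x k t := by
    intro x hx
    unfold WD
    rw [hx]
    have := hU0 (x + (1 - t) • k)
    have := hU0 (x + (-t) • k)
    have : 0 ≤ 1 - t := by linarith
    simp only [sub_zero]
    positivity
  by_cases hx : x 0 ≤ 0
  · exact hz x (hUz x hx)
  push Not at hx
  obtain ⟨B, hB, HB⟩ := growth_est ha hU h0 h1 hM hg k
  have hT0 := ha.T_pos.2
  have ha0 := ha.T_pos.1 0
  set T := ∑ i, a i i with hT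
  set κ := 2 * T / a 0 0 with hκ
  have hκ0 : 0 < κ := by positivity
  have hWc : Continuous fun y => WD U y k t := by
    unfold WD
    have c1 : Continuous fun y => U (y + (1 - t) • k) := hU.comp (by fun_prop)
    have c2 : Continuous fun y => U (y + (-t) • k) := hU.comp (by fun_prop)
    fun_prop
  have claim : ∀ ρ : ℝ, 1 ≤ ρ → 2 * ‖k‖ ≤ ρ → ‖x‖ ≤ ρ ^ 3 →
      0 ≤ WD U x k t + B * ρ ^ 2 * ev x (bP κ (ρ ^ 3)) := by
    intro ρ hρ hkρ hxρ
    have hρ0 : 0 < ρ := by linarith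
    set R := ρ ^ 3 with hR
    have hR0 : 0 < R := by positivity
    set β : Pol n := MvPolynomial.C (B * ρ ^ 2) * bP κ R with hβ
    have hLβ : Lop a β = MvPolynomial.C (-(B * ρ ^ 2 * (2 * T / R ^ 2))) := by
      rw [hβ, Lop_C_mul, Lop_bP ha, ← hT, ← map_mul]
      congr 1
      rw [hκ]; field_simp; ring
    have evβ : ∀ y, ev y β = B * ρ ^ 2 * ev y (bP κ R) := by
      intro y; rw [hβ, map_mul, ev_C]
    have hbp : ∀ y : En n, ‖y‖ ≤ R → 0 ≤ y 0 → ‖y‖ ^ 2 / R ^ 2 ≤ ev y (bP κ R) := by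
      intro y hy hy0
      rw [ev_bP _ _ hR0]
      have : y 0 / R ≤ 1 := by
        rw [div_le_one hR0]
        exact (le_abs_self _).trans ((abs_coord_le y 0).trans hy)
      have : 0 ≤ κ * (y 0 / R) * (1 - y 0 / R) :=
        mul_nonneg (by positivity) (by linarith)
      linarith
    have hKc : IsCompact (closedBall (0 : En n) R ∩ {y : En n | 0 ≤ y 0}) :=
      (isCompact_closedBall _ _).inter_right (isClosed_le continuous_const (by fun_prop))
    have hGc : Continuous fun y => WD U y k t + ev y β := hWc.add (ev_continuous β)
    have hxK : x ∈ closedBall (0 : En n) R ∩ {y : En n | 0 ≤ y 0} :=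
      ⟨by simpa using hxρ, hx.le⟩
    obtain ⟨y, hyK, hymin⟩ := hKc.exists_isMinOn ⟨x, hxK⟩ hGc.continuousOn
    have hyR : ‖y‖ ≤ R := by simpa using hyK.1
    have hy0 : 0 ≤ y 0 := hyK.2
    have hb := hbp y hyR hy0
    have hb0 : 0 ≤ ev y (bP κ R) := le_trans (by positivity) hb
    have hge : 0 ≤ WD U y k t + ev y β := by
      by_contra hneg
      push Not at hneg
      have hβ0 : 0 ≤ ev y β := by rw [evβ]; positivity
      have hUy : 0 < U y := by
        rcases (hU0 y).eq_or_lt with h | h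
        · have := hz y h.symm
          linarith
        · exact h
      have hylt : ‖y‖ < R := by
        rcases hyR.eq_or_lt with h | h
        · exfalso
          rw [h, div_self (by positivity)] at hb
          have hw := (abs_le.1 (HB ρ y t hρ hkρ hyR ht0 ht1)).1
          rw [evβ] at hneg
          nlinarith [mul_pos hB (pow_pos hρ0 2)]
        · exact h
      have hopen : IsOpen {w : En n | 0 < U w ∧ ‖w‖ < R} :=
        (isOpen_lt continuous_const hU).inter (isOpen_lt continuous_norm continuous_const)
      obtain ⟨δ, hδ, hsub⟩ := Metric.nhds_basis_closedBall.mem_iff.1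
        (hopen.mem_nhds (show y ∈ _ from ⟨hUy, hylt⟩))
      refine no_min ha hU h1 h2 k ht0 ht1 β _ (by positivity) hLβ hδ
        (fun w hw => (hsub hw).1) (fun w hw => ?_)
      have hw' := hsub hw
      apply hymin
      refine ⟨by simpa using hw'.2.le, ?_⟩
      by_contra hcon
      have hcon' : ¬ (0 ≤ w 0) := hcon
      have := hUz w (by linarith)
      have h5 : 0 < U w := hw'.1
      linarith
    have := hymin hxK
    have h6 : WD U y k t + ev y β ≤ WD U x k t + ev x β := this
    rw [← evβ]; linarith
  refine lim_arg hB hκ0 hx (norm_nonneg x) (norm_nonneg k) fun ρ hρ1 hρ2 hρ3 => ?_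
  have hc := claim ρ hρ1 hρ2 hρ3
  rwa [ev_bP _ _ (by positivity)] at hc

lemma F_lin {n : ℕ} {lam Lam : ℝ} {F : Matrix (Fin n) (Fin n) ℝ → ℝ} (hF : EllipticF n lam Lam F) :
    ∃ L : Matrix (Fin n) (Fin n) ℝ →ₗ[ℝ] ℝ, ∀ A, F A = L A := by
  have hd : HasFDerivAt F (fderiv ℝ F 0) 0 :=
    ((hF.smoothF.differentiable (by norm_num)) 0).hasFDerivAt
  refine ⟨(fderiv ℝ F 0 : Matrix (Fin n) (Fin n) ℝ →L[ℝ] ℝ).toLinearMap, fun A => ?_⟩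
  have h1 : HasDerivAt (fun t : ℝ => t • A) A 0 := by
    have h := (hasDerivAt_id (0 : ℝ)).smul_const A
    rw [one_smul] at h
    exact h
  have hd' : HasFDerivAt F (fderiv ℝ F 0) ((0 : ℝ) • A) := by rw [zero_smul]; exact hd
  have h2 : HasDerivAt (fun t : ℝ => F (t • A)) (fderiv ℝ F 0 A) 0 :=
    HasFDerivAt.comp_hasDerivAt (0 : ℝ) hd' h1
  have h3 : HasDerivAt (fun t : ℝ => F (t • A)) (F A) 0 := by
    have e : (fun t : ℝ => F (t • A)) = fun t => t * F A := funext fun t => hF.homogeneous t A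
    rw [e]
    simpa using (hasDerivAt_id (0 : ℝ)).mul_const (F A)
  exact h3.unique h2

lemma matOpNorm_nonneg {n : ℕ} (N : Matrix (Fin n) (Fin n) ℝ) : 0 ≤ matOpNorm N := norm_nonneg _

lemma opNorm_rank_one {n : ℕ} (y : En n) :
    ‖y‖ ^ 2 ≤ matOpNorm (Matrix.of fun i j => y i * y j) := by
  set N : Matrix (Fin n) (Fin n) ℝ := Matrix.of fun i j => y i * y j with hN
  have h := (Matrix.toEuclideanCLM (𝕜 := ℝ) N).le_opNorm y
  have e : Matrix.toEuclideanCLM (𝕜 := ℝ) N y = (‖y‖ ^ 2) • y := by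
    ext i
    rw [EuclideanSpace.real_norm_sq_eq]
    simp only [Matrix.ofLp_toEuclideanCLM, Matrix.mulVec, dotProduct, hN, Matrix.of_apply,
      PiLp.smul_apply, smul_eq_mul, Finset.sum_mul]
    refine Finset.sum_congr rfl fun j _ => ?_
    ring
  rw [e, norm_smul, Real.norm_eq_abs, abs_of_nonneg (by positivity)] at h
  by_cases hy : y = 0
  · rw [hy]; simpa using matOpNorm_nonneg _
  · exact le_of_mul_le_mul_right h (norm_pos_iff.2 hy)

lemma coef_exists {n : ℕ} {lam Lam : ℝ} {F : Matrix (Fin n) (Fin n) ℝ → ℝ}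
    (hF : EllipticF n lam Lam F) :
    ∃ a : Matrix (Fin n) (Fin n) ℝ, Coef a lam ∧ ∀ A : Matrix (Fin n) (Fin n) ℝ, A.IsSymm →
      F A = LA a A := by
  obtain ⟨L, hL⟩ := F_lin hF
  set l : Fin n → Fin n → ℝ := fun i j => L (Matrix.single i j 1) with hl
  have hA : ∀ A, F A = ∑ i, ∑ j, l i j * A i j := by
    intro A
    rw [hL]
    conv_lhs => rw [Matrix.matrix_eq_sum_single A]
    simp only [map_sum]
    refine Finset.sum_congr rfl fun i _ => Finset.sum_congr rfl fun j _ => ?_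
    rw [show Matrix.single i j (A i j) = A i j • Matrix.single i j (1 : ℝ) by simp,
      map_smul, smul_eq_mul, mul_comm]
  set a : Matrix (Fin n) (Fin n) ℝ := Matrix.of fun i j => (l i j + l j i) / 2 with haa
  have hs : ∀ A : Matrix (Fin n) (Fin n) ℝ, A.IsSymm → F A = LA a A := by
    intro A hAs
    have e1 : ∑ i, ∑ j, l j i * A i j = ∑ i, ∑ j, l i j * A i j := by
      rw [Finset.sum_comm]
      refine Finset.sum_congr rfl fun i _ => Finset.sum_congr rfl fun j _ => ?_
      rw [hAs.apply i j]
    have e2 : LA a A = (∑ i, ∑ j, l i j * A i j + ∑ i, ∑ j, l j i * A i j) / 2 := by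
      simp only [LA, haa, Matrix.of_apply, ← Finset.sum_add_distrib, Finset.sum_div]
      refine Finset.sum_congr rfl fun i _ => Finset.sum_congr rfl fun j _ => ?_
      ring
    rw [e2, e1, hA]; ring
  have hps : ∀ N : Matrix (Fin n) (Fin n) ℝ, N.PosSemidef → lam * matOpNorm N ≤ LA a N := by
    intro N hN
    have h := hF.elliptic_lower 0 N (by simp [Matrix.IsSymm]) hN
    have h0 : F 0 = 0 := by rw [hL, map_zero]
    rw [zero_add, h0, sub_zero] at h
    rw [← hs N (by
      have := hN.isHermitian
      rwa [Matrix.IsHermitian, Matrix.conjTranspose_eq_transpose_of_trivial] at this)]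
    exact h
  refine ⟨a, ⟨?_, hF.lam_pos, ?_, ?_⟩, hs⟩
  · intro i j
    simp only [haa, Matrix.of_apply]; ring
  · intro y
    have hN : (Matrix.of fun i j => y i * y j : Matrix (Fin n) (Fin n) ℝ).PosSemidef := by
      apply psd_of_QF
      · ext i j; simp [mul_comm]
      · intro z
        have : QF (Matrix.of fun i j => y i * y j) z = (∑ i, y i * z i) ^ 2 := by
          rw [pow_two, Finset.sum_mul_sum, QF]
          refine Finset.sum_congr rfl fun i _ => Finset.sum_congr rfl fun j _ => ?_
          simp only [Matrix.of_apply]; ring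
        rw [this]; positivity
    have h1 := hps _ hN
    have h2 := opNorm_rank_one (WithLp.toLp 2 y : En n)
    rw [EuclideanSpace.real_norm_sq_eq] at h2
    have h3 : LA a (Matrix.of fun i j => y i * y j) = ∑ i, ∑ j, a i j * y i * y j := by
      refine Finset.sum_congr rfl fun i _ => Finset.sum_congr rfl fun j _ => ?_
      simp only [Matrix.of_apply]; ring
    rw [← h3]
    exact (mul_le_mul_of_nonneg_left h2 hF.lam_pos.le).trans h1
  · intro A hA'
    exact le_trans (mul_nonneg hF.lam_pos.le (matOpNorm_nonneg A)) (hps A hA')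

lemma QF_smulv {n : ℕ} (A : Matrix (Fin n) (Fin n) ℝ) (s : ℝ) (y : En n) :
    QF A (s • y) = s ^ 2 * QF A y := by
  simp only [QF, Finset.mul_sum, PiLp.smul_apply, smul_eq_mul]
  refine Finset.sum_congr rfl fun i _ => Finset.sum_congr rfl fun j _ => ?_
  ring

lemma ViSup_zero {n : ℕ} [NeZero n] {a : Matrix (Fin n) (Fin n) ℝ} {lam : ℝ} (ha : Coef a lam)
    {U : En n → ℝ} (hUz : ∀ x : En n, x 0 ≤ 0 → U x = 0) {x : En n} (hx : x 0 ≤ 0)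
    (hg : HasFDerivAt U (0 : En n →L[ℝ] ℝ) x) : ViSup a U 1 x := by
  intro c0 b A hA hm
  have line : ∀ y : En n, Tendsto (fun s : ℝ => x + s • y) (nhds 0) (nhds x) := by
    intro y
    have : Continuous fun s : ℝ => x + s • y := by fun_prop
    simpa using this.tendsto 0
  have q : ∀ (y : En n) (s : ℝ), quadPoly c0 b A (x + s • y) = quadPoly c0 b A x +
      s * (∑ i, (b i + ∑ j, A i j * x j) * y i) + (1 / 2) * (s ^ 2 * QF A y) := by
    intro y s
    rw [quad_shift _ _ _ hA, QF_smulv, Finset.mul_sum]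
    congr 2
    refine Finset.sum_congr rfl fun i _ => ?_
    simp only [PiLp.smul_apply, smul_eq_mul]; ring
  have hG : ∀ y : En n, ∑ i, (b i + ∑ j, A i j * x j) * y i = 0 := by
    intro y
    set G := ∑ i, (b i + ∑ j, A i j * x j) * y i with hGd
    have h1 : HasDerivAt (fun s : ℝ => x + s • y) y 0 := by
      simpa using ((hasDerivAt_id (0 : ℝ)).smul_const y).const_add x
    have hg' : HasFDerivAt U (0 : En n →L[ℝ] ℝ) (x + (0 : ℝ) • y) := by simpa using hg
    have h2 : HasDerivAt (fun s : ℝ => U (x + s • y)) 0 0 := by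
      have h := HasFDerivAt.comp_hasDerivAt (0 : ℝ) hg' h1
      exact h
    have h3 : HasDerivAt (fun s : ℝ => quadPoly c0 b A (x + s • y)) G 0 := by
      have e : (fun s : ℝ => quadPoly c0 b A (x + s • y)) = fun s : ℝ =>
        quadPoly c0 b A x + s * G + (1 / 2) * (s ^ 2 * QF A y) := funext fun s => q y s
      rw [e]
      have d1 : HasDerivAt (fun s : ℝ => quadPoly c0 b A x + s * G) G 0 := by
        simpa using ((hasDerivAt_id (0 : ℝ)).mul_const G).const_add (quadPoly c0 b A x)
      have d2 : HasDerivAt (fun s : ℝ => (1 / 2) * (s ^ 2 * QF A y)) 0 0 := by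
        simpa using (((hasDerivAt_id (0 : ℝ)).pow 2).mul_const (QF A y)).const_mul (1 / 2 : ℝ)
      have h := d1.add d2
      rw [add_zero] at h
      exact h
    have h4 : IsLocalMin (fun s : ℝ => U (x + s • y) - quadPoly c0 b A (x + s • y)) 0 := by
      filter_upwards [(line y).eventually hm] with s hs
      simpa using hs
    have := h4.hasDerivAt_eq_zero (h2.sub h3)
    linarith
  have hneg : ∀ y : En n, y 0 ≤ 0 → QF A y ≤ 0 := by
    intro y hy
    obtain ⟨s, hs, hs0⟩ := (((line y).eventually hm).filter_mono
      (nhdsWithin_le_nhds (s := Ioi (0 : ℝ)))).and self_mem_nhdsWithin |>.exists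
    have hs0' : 0 < s := hs0
    beta_reduce at hs
    rw [hUz x hx, hUz (x + s • y) (by
      simp only [PiLp.add_apply, PiLp.smul_apply, smul_eq_mul]
      nlinarith [mul_nonneg hs0'.le (neg_nonneg.2 hy)]), q, hG] at hs
    have : 0 < s ^ 2 := by positivity
    by_contra hc
    push Not at hc
    have := mul_pos this hc
    linarith
  have hall : ∀ y : En n, QF A y ≤ 0 := by
    intro y
    rcases le_total (y 0) 0 with h | h
    · exact hneg y h
    · have h1 := hneg ((-1 : ℝ) • y) (by simpa using h)
      rw [QF_smulv] at h1
      linarith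
  have hp := ha.pos ((-1 : ℝ) • A) (psd_of_QF (by
    rw [Matrix.IsSymm, Matrix.transpose_smul, hA.eq]) (fun y => by
    rw [QF_smulm]; linarith [hall y]))
  rw [LA_smul] at hp
  linarith

open Classical in
def Uext {n : ℕ} [NeZero n] (u : En n → ℝ) (x : En n) : ℝ := if 0 ≤ x 0 then u x else 0

lemma Uext_eq {n : ℕ} [NeZero n] (u : En n → ℝ) {x : En n} (hx : 0 ≤ x 0) : Uext u x = u x := by
  simp [Uext, hx]

lemma Uext_neg {n : ℕ} [NeZero n] {u : En n → ℝ} (hu : ∀ x ∈ PiSet n, u x = 0)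
    {x : En n} (hx : x 0 ≤ 0) : Uext u x = 0 := by
  rcases hx.eq_or_lt with h | h
  · rw [Uext_eq u h.ge]; exact hu x h
  · simp [Uext, not_le.2 h]

lemma c0_cont {n : ℕ} [NeZero n] : Continuous fun x : En n => x 0 := by fun_prop

lemma Uext_cont {n : ℕ} [NeZero n] {u : En n → ℝ} (hc : ContinuousOn u (HcloSet n))
    (hu : ∀ x ∈ PiSet n, u x = 0) : Continuous (Uext u) := by
  have h1 : IsClosed (HcloSet n) := isClosed_le continuous_const c0_cont
  have h2 : IsClosed {x : En n | x 0 ≤ 0} := isClosed_le c0_cont continuous_const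
  have h3 : HcloSet n ∪ {x : En n | x 0 ≤ 0} = univ := by
    ext x; simpa [HcloSet] using le_total 0 (x 0)
  rw [← continuousOn_univ, ← h3]
  refine ContinuousOn.union_of_isClosed ?_ ?_ h1 h2
  · exact hc.congr fun x hx => Uext_eq u hx
  · exact (continuousOn_const (c := (0 : ℝ))).congr fun x hx => Uext_neg hu hx

lemma Uext_deriv {n : ℕ} [NeZero n] {u : En n → ℝ} (hu : ∀ x ∈ PiSet n, u x = 0)
    (hgrad : ∀ x ∈ PiSet n, HasGradientWithinAt u 0 (HcloSet n) x) {x : En n} (hx : x 0 ≤ 0) :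
    HasFDerivAt (Uext u) (0 : En n →L[ℝ] ℝ) x := by
  have hz : HasFDerivWithinAt (Uext u) (0 : En n →L[ℝ] ℝ) {x : En n | x 0 ≤ 0} x :=
    (hasFDerivWithinAt_const (0 : ℝ) x _).congr (fun y hy => Uext_neg hu hy) (Uext_neg hu hx)
  rcases hx.eq_or_lt with h | h
  · have h1 : HasFDerivWithinAt (Uext u) (0 : En n →L[ℝ] ℝ) (HcloSet n) x := by
      have := (hgrad x h).hasFDerivWithinAt
      rw [map_zero] at this
      exact this.congr (fun y hy => Uext_eq u hy) (Uext_eq u h.ge)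
    have h3 : HcloSet n ∪ {x : En n | x 0 ≤ 0} = univ := by
      ext x; simpa [HcloSet] using le_total 0 (x 0)
    rw [← hasFDerivWithinAt_univ, ← h3]
    exact h1.union hz
  · refine hz.hasFDerivAt ?_
    filter_upwards [(isOpen_lt c0_cont continuous_const).mem_nhds h] with y hy
    exact le_of_lt hy

theorem global_solution_convex (n : ℕ) [NeZero n] (hn : 2 ≤ n) (lam Lam : ℝ)
    (F : Matrix (Fin n) (Fin n) ℝ → ℝ) (hF : EllipticF n lam Lam F)
    (M : ℝ) (hM : 0 < M) (u : En n → ℝ) (Ω : Set (En n)) (hu : MemPinf F M u Ω)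
    (hnonneg : ∀ x ∈ HplusSet n, 0 ≤ u x)
    (hgrad : ∀ x ∈ PiSet n, HasGradientWithinAt u 0 (HcloSet n) x) :
    ∀ x ∈ HcloSet n, ∀ y ∈ HcloSet n, ∀ t : ℝ, 0 ≤ t → t ≤ 1 →
      u (t • x + (1 - t) • y) ≤ t * u x + (1 - t) * u y := by
  obtain ⟨a, ha, hFa⟩ := coef_exists hF
  have hz := hu.bdry_zero
  have hUz : ∀ x : En n, x 0 ≤ 0 → Uext u x = 0 := fun x hx => Uext_neg hz hx
  have hU0 : ∀ x, 0 ≤ Uext u x := by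
    intro x
    rcases le_or_gt (x 0) 0 with h | h
    · rw [hUz x h]
    · rw [Uext_eq u h.le]; exact hnonneg x h
  have hnear : ∀ x : En n, 0 < x 0 → ∀ᶠ y in nhds x, Uext u y = u y := by
    intro x hx
    filter_upwards [(isOpen_lt continuous_const c0_cont).mem_nhds hx] with y hy
    exact Uext_eq u (le_of_lt hy)
  have hmax : ∀ x : En n, 0 < x 0 → ∀ c, c ≤ Ω.indicator (fun _ => (1 : ℝ)) x →
      ViSub a (Uext u) c x := by
    intro x hx c hc c0 b A hA hm
    rw [← hFa A hA]
    refine hc.trans ((hu.sol x hx).1 c0 b A hA ?_)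
    refine IsLocalMax.on ?_ _
    filter_upwards [hm, hnear x hx] with y hy hy'
    rw [hy', Uext_eq u hx.le] at hy
    exact hy
  have hmin : ∀ x : En n, 0 < x 0 → ViSup a (Uext u) 1 x := by
    intro x hx c0 b A hA hm
    rw [← hFa A hA]
    refine ((hu.sol x hx).2 c0 b A hA ?_).trans ?_
    · refine IsLocalMin.on ?_ _
      filter_upwards [hm, hnear x hx] with y hy hy'
      rw [hy', Uext_eq u hx.le] at hy
      exact hy
    · exact Set.indicator_le_self' (fun _ _ => zero_le_one) x
  have h0 : ∀ x, ViSub a (Uext u) 0 x := by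
    intro x
    rcases le_or_gt (x 0) 0 with h | h
    · exact ViSub_of_zero_min ha hU0 (hUz x h)
    · exact hmax x h 0 (Set.indicator_nonneg (fun _ _ => zero_le_one) x)
  have h1 : ∀ x, ViSup a (Uext u) 1 x := by
    intro x
    rcases le_or_gt (x 0) 0 with h | h
    · exact ViSup_zero ha hUz h (Uext_deriv hz hgrad h)
    · exact hmin x h
  have h2 : ∀ x, 0 < Uext u x → ViSub a (Uext u) 1 x := by
    intro x hx
    rcases le_or_gt (x 0) 0 with h | h
    · rw [hUz x h] at hx; exact absurd hx (lt_irrefl _)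
    · apply hmax x h
      by_cases hxO : x ∈ Ω
      · rw [Set.indicator_of_mem hxO]
      · have := (hu.vanish x ⟨h, hxO⟩).1
        rw [Uext_eq u h.le, this] at hx
        exact absurd hx (lt_irrefl _)
  have hg : ∀ x, |Uext u x| ≤ M * (‖x‖ ^ 2 + 1) := by
    intro x
    rcases le_or_gt (x 0) 0 with h | h
    · rw [hUz x h, abs_zero]; positivity
    · rw [Uext_eq u h.le]; exact hu.growth x
  intro x hx y hy t ht0 ht1
  have key := WD_nonneg ha (Uext_cont hu.cont hz) hU0 hUz h0 h1 h2 hM hg (x - y) ht0 ht1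
    (t • x + (1 - t) • y)
  have e1 : t • x + (1 - t) • y + (1 - t) • (x - y) = x := by module
  have e2 : t • x + (1 - t) • y + (-t) • (x - y) = y := by module
  have hx' : 0 ≤ x 0 := hx
  have hy' : 0 ≤ y 0 := hy
  have hzz : 0 ≤ (t • x + (1 - t) • y) 0 := by
    simp only [PiLp.add_apply, PiLp.smul_apply, smul_eq_mul]
    have : 0 ≤ 1 - t := by linarith
    positivity
  rw [WD, e1, e2, Uext_eq u hx', Uext_eq u hy', Uext_eq u hzz] at key
  linarith
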